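/- arXiv:0912.2513 — 16 statements merged into one kernel-verified Lean document; each statement's English description precedes it below -/
import Mathlib

section
/- The Frobenius number g of {d0, d1, d2, d3} satisfies g2 ≤ g ≤ g0; that is, g2 is not exceeded by the Frobenius number, and every integer greater than g0 is representable while g itself is not representable. -/
/-- `n` is representable as a nonnegative integer combination of `d0, d1, d2, d3`. -/
def Representable (d0 d1 d2 d3 n : ℤ) : Prop :=
  ∃ x y z w : ℤ, 0 ≤ x ∧ 0 ≤ y ∧ 0 ≤ z ∧ 0 ≤ w ∧
    n = x * d0 + y * d1 + z * d2 + w * d3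

/-- `g` is the Frobenius number of `{d0, d1, d2, d3}`:
it is not representable, and every larger integer is representable. -/
def IsFrob (d0 d1 d2 d3 g : ℤ) : Prop :=
  ¬ Representable d0 d1 d2 d3 g ∧ ∀ n : ℤ, g < n → Representable d0 d1 d2 d3 n

/-- With coins of odd values `1` and `p`, paying `i * (κ * p + lam) + (κ - 1) * p + 2` takes at least
`i + κ + 1` coins when `lam` has the parity that makes `κ * p + lam` odd. -/
theorem le_coin_count {p κ lam i z w : ℤ} (hp : Odd p) (hq : Odd (κ * p + lam)) (h2p : 2 < p)
    (hκ : 1 ≤ κ) (hlam : 1 ≤ lam) (hi : 0 ≤ i) (hw : 0 ≤ w)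
    (h : z * p + w = i * (κ * p + lam) + (κ - 1) * p + 2) : i + κ + 1 ≤ z + w := by
  obtain ⟨m, rfl⟩ : ∃ m, z = i * κ + κ - 1 + m := ⟨z - (i * κ + κ - 1), by ring⟩
  have hm : m * p + w = i * lam + 2 := by linear_combination h
  have hil : 0 ≤ i * lam := by positivity
  have hiκ : 0 ≤ i * (κ - 1) := mul_nonneg hi (by linarith)
  suffices 2 ≤ i * (κ - 1) + m + w by linarith
  rcases le_or_gt m 0 with hm0 | hm0
  · nlinarith
  by_contra! hlt
  obtain rfl : m = 1 := by omega
  obtain rfl : w = 0 := by omega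
  have hz : i * (κ - 1) = 0 := by omega
  rcases mul_eq_zero.1 hz with rfl | hκ1
  · omega
  obtain rfl : κ = 1 := by omega
  obtain ⟨a, rfl⟩ := hp
  obtain ⟨b, hb⟩ := hq
  obtain ⟨c, rfl⟩ : ∃ c, lam = 2 * c := ⟨b - a, by omega⟩
  have : i * (2 * c) = 2 * (i * c) := by ring
  omega

/-- Every integer whose double exceeds the stated bound is representable. -/
theorem representable_of_lt {p q κ lam d0 d1 d2 d3 n : ℤ} (hpo : Odd p) (hqo : Odd q)
    (h2p : 2 < p) (hpq : p < q) (hdiv : q = κ * p + lam) (hlam : lam ≤ p - 1)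
    (hd0 : d0 = p * q) (hd1 : 2 * d1 = (p - 1) * q) (hd2 : 2 * d2 = p * (q - 1))
    (hd3 : 2 * d3 = p * q - 1)
    (hn : (2 * p + κ - 5) * (p * q) - (p - 1) * q - κ * p + 1 < 2 * n) :
    Representable d0 d1 d2 d3 n := by
  have hp0 : 0 < p := by linarith
  have hq0 : 0 < q := by linarith
  have hpq0 : 0 < p * q := by positivity
  set t := (-2 * n) % (p * q) with ht
  set s := -((-2 * n) / (p * q)) with hs
  have hst : 2 * n = s * (p * q) - t := by
    have := Int.mul_ediv_add_emod (-2 * n) (p * q)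
    rw [hs, ht]; linear_combination this
  have ht1 : t < p * q := Int.emod_lt_of_pos _ hpq0
  have ht0 : 0 ≤ t := Int.emod_nonneg _ hpq0.ne'
  clear_value t s
  obtain ⟨a, r, ha0, hr0, hrq, hat⟩ : ∃ a r, 0 ≤ a ∧ 0 ≤ r ∧ r < q ∧ t = a * q + r :=
    ⟨t / q, t % q, Int.ediv_nonneg ht0 hq0.le, Int.emod_nonneg _ hq0.ne', Int.emod_lt_of_pos _ hq0,
      by linarith [Int.mul_ediv_add_emod t q, mul_comm q (t / q)]⟩
  obtain ⟨b, c, hb0, hc0, hcp, hbr⟩ : ∃ b c, 0 ≤ b ∧ 0 ≤ c ∧ c < p ∧ r = b * p + c :=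
    ⟨r / p, r % p, Int.ediv_nonneg hr0 hp0.le, Int.emod_nonneg _ hp0.ne', Int.emod_lt_of_pos _ hp0,
      by linarith [Int.mul_ediv_add_emod r p, mul_comm p (r / p)]⟩
  have hap : a ≤ p - 1 := by
    by_contra! h
    nlinarith
  obtain ⟨x, hx⟩ : ∃ x, s - (a + b + c) = 2 * x := by
    obtain ⟨u, hu⟩ := hpo
    obtain ⟨v, hv⟩ := hqo
    refine ⟨n - s * (2 * u * v + u + v) + a * v + b * u, ?_⟩
    subst hu hv
    subst hbr
    linear_combination hat - hst
  have hkey : s * (p * q) - t = 2 * x * (p * q) + a * ((p - 1) * q) + b * (p * (q - 1))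
      + c * (p * q - 1) := by
    subst hbr
    linear_combination (p * q) * hx - hat
  rcases le_or_gt 0 x with hx0 | hx0
  · refine ⟨x, a, b, c, hx0, ha0, hb0, hc0, ?_⟩
    have : 2 * n = 2 * (x * d0 + a * d1 + b * d2 + c * d3) := by
      rw [hst, hkey]
      linear_combination (-2 * x) * hd0 - a * hd1 - b * hd2 - c * hd3
    linarith
  exfalso
  have h1 : a * ((p - 1) * q) ≤ (p - 1) * ((p - 1) * q) :=
    mul_le_mul_of_nonneg_right hap (mul_nonneg (by linarith) hq0.le)
  have h2 : 2 * x * (p * q) ≤ -2 * (p * q) :=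
    mul_le_mul_of_nonneg_right (by linarith) hpq0.le
  have h3 : b * (p * (q - 1)) + c * (p * q - 1)
      ≤ (κ - 1) * (p * (q - 1)) + (p - 1) * (p * q - 1) := by
    have hbκ : b ≤ κ := by
      by_contra! h
      nlinarith
    have hA : 0 ≤ p * (q - 1) := mul_nonneg hp0.le (by linarith)
    have hB : 0 ≤ p * q - 1 := by linarith
    rcases hbκ.lt_or_eq with hlt | rfl
    · have h4 : b * (p * (q - 1)) ≤ (κ - 1) * (p * (q - 1)) :=
        mul_le_mul_of_nonneg_right (by linarith) hA
      have h5 : c * (p * q - 1) ≤ (p - 1) * (p * q - 1) :=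
        mul_le_mul_of_nonneg_right (by linarith) hB
      linarith
    · have h5 : c * (p * q - 1) ≤ (p - 2) * (p * q - 1) :=
        mul_le_mul_of_nonneg_right (by linarith) hB
      linarith
  linarith

/-- No integer whose double equals the stated value is representable. -/
theorem not_representable_of_two_mul_eq {p q κ lam d0 d1 d2 d3 n : ℤ} (hpo : Odd p) (hqo : Odd q)
    (h2p : 2 < p) (hpq : p < q) (hdiv : q = κ * p + lam) (hlam1 : 1 ≤ lam) (hlam2 : lam ≤ p - 1)
    (hd0 : d0 = p * q) (hd1 : 2 * d1 = (p - 1) * q) (hd2 : 2 * d2 = p * (q - 1))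
    (hd3 : 2 * d3 = p * q - 1)
    (hn : 2 * n = (p + κ - 2) * (p * q) - ((p - 1) * q + (κ - 1) * p + 2)) :
    ¬ Representable d0 d1 d2 d3 n := by
  rintro ⟨x, y, z, w, hx, hy, hz, hw, h⟩
  have hp0 : 0 < p := by linarith
  have hq0 : 0 < q := by linarith
  have hpq0 : 0 < p * q := by positivity
  have hκ : 1 ≤ κ := by
    by_contra! hlt
    nlinarith
  obtain ⟨j, hj⟩ : ∃ j, 2 * x + y + z + w = p + κ - 2 + j :=
    ⟨2 * x + y + z + w - (p + κ - 2), by ring⟩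
  have ht : y * q + z * p + w = (p - 1 + j * p) * q + (κ - 1) * p + 2 := by
    linear_combination -hn + 2 * h + 2 * x * hd0 + y * hd1 + z * hd2 + w * hd3 + (p * q) * hj
  have hj0 : 0 ≤ j := by
    by_contra! hlt
    have h1 : j * (p * q) ≤ -1 * (p * q) := mul_le_mul_of_nonneg_right (by linarith) hpq0.le
    have h2 : 0 ≤ y * q + z * p + w := by positivity
    linarith
  have hi0 : 0 ≤ p - 1 + j * p - y := by
    by_contra! hlt
    have h1 : (p + j * p) * q ≤ y * q := mul_le_mul_of_nonneg_right (by linarith) hq0.le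
    have h2 : 0 ≤ z * p := by positivity
    linarith
  have hc := le_coin_count (z := z) hpo (hdiv ▸ hqo) h2p hκ hlam1 hi0 hw
    (by rw [← hdiv]; linear_combination ht)
  have : 0 ≤ j * (p - 1) := mul_nonneg hj0 (by linarith)
  linarith

theorem frobenius_between_g2_and_g0
    (p q p' q' κ lam κ' lam' d0 d1 d2 d3 g0 g2 g : ℤ)
    (hp : Prime p) (hq : Prime q) (h2p : 2 < p) (hpq : p < q)
    (hp' : p = 2 * p' + 1) (hq' : q = 2 * q' + 1)
    (hdiv : q = κ * p + lam) (hlam1 : 1 ≤ lam) (hlam2 : lam ≤ p - 1)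
    (hdiv' : q' = κ' * p' + lam') (hlam'1 : 0 ≤ lam') (hlam'2 : lam' ≤ p' - 1)
    (hd0 : d0 = p * q) (hd1 : d1 = p' * q) (hd2 : d2 = p * q')
    (hd3 : 2 * d3 = p * q - 1)
    (hg0 : g0 = (p' - 1) * d0 + (p - 1) * d1 + κ * d2 - d3)
    (hg2 : g2 = g0 - (p - 3) * d3)
    (hfrob : IsFrob d0 d1 d2 d3 g) :
    g2 ≤ g ∧ g ≤ g0 := by
  have hpo : Odd p := ⟨p', hp'⟩
  have hqo : Odd q := ⟨q', hq'⟩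
  have hd1' : 2 * d1 = (p - 1) * q := by rw [hd1, hp']; ring
  have hd2' : 2 * d2 = p * (q - 1) := by rw [hd2, hq']; ring
  have hg0' : 2 * g0 = (2 * p + κ - 5) * (p * q) - (p - 1) * q - κ * p + 1 := by
    linear_combination 2 * hg0 + 2 * (p' - 1) * hd0 + (p - 1) * hd1' + κ * hd2' - hd3
      - (p * q) * hp'
  constructor
  · by_contra! hlt
    refine not_representable_of_two_mul_eq hpo hqo h2p hpq hdiv hlam1 hlam2 hd0 hd1' hd2' hd3 ?_
      (hfrob.2 g2 hlt)
    linear_combination 2 * hg2 + hg0' - (p - 3) * hd3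
  · by_contra! hlt
    exact hfrob.1 (representable_of_lt hpo hqo h2p hpq hdiv hlam2 hd0 hd1' hd2' hd3 (by linarith))
end

section
/- The Frobenius number g of {d0, d1, d2, d3} equals g0 if and only if κ + λ ≥ p. -/
/-- Representability by `p * q, p' * q, p * q', (p * q - 1) / 2` (with `p = 2 * p' + 1`,
`q = 2 * q' + 1`) is a change-making problem with coins `q, p, 1`: the number `n` is representable
iff some `T * (p * q) - 2 * n` can be paid with at most `T` coins. -/
theorem representable_iff_exists_change {p q p' q' d3 n : ℤ}
    (hp' : p = 2 * p' + 1) (hq' : q = 2 * q' + 1) (hd3 : 2 * d3 = p * q - 1) :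
    Representable (p * q) (p' * q) (p * q') d3 n ↔
      ∃ T y z w : ℤ, 0 ≤ y ∧ 0 ≤ z ∧ 0 ≤ w ∧ y + z + w ≤ T ∧
        2 * n = T * (p * q) - (y * q + z * p + w) := by
  have hm : d3 = 2 * p' * q' + p' + q' := by
    have : 2 * d3 = 2 * (2 * p' * q' + p' + q') := by rw [hd3, hp', hq']; ring
    linarith
  subst hp' hq' hm
  constructor
  · rintro ⟨x, y, z, w, hx, hy, hz, hw, h⟩
    refine ⟨2 * x + y + z + w, y, z, w, hy, hz, hw, by linarith, ?_⟩
    rw [h]; ring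
  · rintro ⟨T, y, z, w, hy, hz, hw, hT, h⟩
    have hx : 2 * (n - T * (2 * p' * q' + p' + q') + y * q' + z * p') = T - (y + z + w) := by
      linear_combination h
    refine ⟨n - T * (2 * p' * q' + p' + q') + y * q' + z * p', y, z, w, by linarith, hy, hz, hw, ?_⟩
    have : 2 * n = 2 * ((n - T * (2 * p' * q' + p' + q') + y * q' + z * p')
        * ((2 * p' + 1) * (2 * q' + 1)) + y * (p' * (2 * q' + 1)) + z * ((2 * p' + 1) * q')
        + w * (2 * p' * q' + p' + q')) := by
      linear_combination h - (2 * p' + 1) * (2 * q' + 1) * hx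
    linarith

/-- A lower bound for the number of coins `q, p, 1` needed to pay `N * q - 1 - lam`, when
`q = κ * p + lam` and the greedy algorithm is optimal. -/
theorem le_coins_of_change_eq {p q κ lam N y z w : ℤ} (hdiv : q = κ * p + lam)
    (hlam1 : 1 ≤ lam) (hlam2 : lam ≤ p - 1) (hq : 0 < q) (hκ : p ≤ κ + lam)
    (hw : 0 ≤ w) (hz : 0 ≤ z) (h : y * q + z * p + w = N * q - 1 - lam) :
    N + p + κ - 3 ≤ y + z + w := by
  obtain ⟨v, rfl⟩ : ∃ v, N = y + v + 1 := ⟨N - y - 1, by ring⟩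
  obtain ⟨j, rfl⟩ : ∃ j, z = (v + 1) * κ + j := ⟨z - (v + 1) * κ, by ring⟩
  have hwv : w = v * lam - 1 - j * p := by subst hdiv; linear_combination h
  have hv : 0 ≤ v := by
    have : 0 < (v + 1) * q := by
      have : 0 ≤ ((v + 1) * κ + j) * p := mul_nonneg hz (by linarith)
      linarith
    have := pos_of_mul_pos_left this hq.le
    linarith
  have key : (j + 1) * (p - 1) ≤ v * (κ + lam - 1) := by
    rcases le_or_gt (j + 1) 0 with hj | hj
    · nlinarith
    · have hjv : j < v := by
        by_contra! hvj
        nlinarith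
      nlinarith
  linarith

theorem frobenius_eq_g0_iff
    (p q p' q' κ lam κ' lam' d0 d1 d2 d3 g0 g : ℤ)
    (hp : Prime p) (hq : Prime q) (h2p : 2 < p) (hpq : p < q)
    (hp' : p = 2 * p' + 1) (hq' : q = 2 * q' + 1)
    (hdiv : q = κ * p + lam) (hlam1 : 1 ≤ lam) (hlam2 : lam ≤ p - 1)
    (hdiv' : q' = κ' * p' + lam') (hlam'1 : 0 ≤ lam') (hlam'2 : lam' ≤ p' - 1)
    (hd0 : d0 = p * q) (hd1 : d1 = p' * q) (hd2 : d2 = p * q')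
    (hd3 : 2 * d3 = p * q - 1)
    (hg0 : g0 = (p' - 1) * d0 + (p - 1) * d1 + κ * d2 - d3)
    (hfrob : IsFrob d0 d1 d2 d3 g) :
    g = g0 ↔ p ≤ κ + lam := by
  subst hd0 hd1 hd2
  have hiff := fun n => representable_iff_exists_change (n := n) hp' hq' hd3
  have hq0 : 0 < q := by linarith
  have hpq0 : 0 < p * q := by positivity
  have hκ1 : 1 ≤ κ := by
    by_contra! hκ
    nlinarith
  have h2g0 : 2 * g0 = (2 * p + κ - 5) * (p * q) - (p * q - 1 - lam) := by
    have e1 : 2 * p' = p - 1 := by linarith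
    have e2 : 2 * q' = q - 1 := by linarith
    linear_combination 2 * hg0 + (p * q + (p - 1) * q) * e1 + κ * p * e2 - hd3 + hdiv
  constructor
  · rintro rfl
    by_contra! hlt
    refine hfrob.1 ((hiff g).2 ⟨2 * p + κ - 5, p - 2, 2 * κ, lam - 1, by linarith, by linarith,
      by linarith, ?_, ?_⟩)
    · have : ∃ t, p - κ - lam = 2 * t := by
        refine ⟨p' - q' + κ * p', ?_⟩
        rw [hp'] at hdiv ⊢
        linear_combination hdiv - hq'
      omega
    · linear_combination h2g0 - 2 * hdiv
  · intro hκ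
    refine le_antisymm ?_ ?_
    · by_contra! hlt
      refine hfrob.1 ((hiff g).2 ?_)
      set s := (-(2 * g)) % (p * q) with hs
      set T := -((-(2 * g)) / (p * q)) with hT
      have hs0 : 0 ≤ s := Int.emod_nonneg _ hpq0.ne'
      have hs1 : s < p * q := Int.emod_lt_of_pos _ hpq0
      have hsT : 2 * g = T * (p * q) - s := by
        have := Int.emod_add_mul_ediv (-(2 * g)) (p * q)
        rw [← hs] at this
        rw [hT]; linear_combination this
      have ha0 : 0 ≤ s / q := Int.ediv_nonneg hs0 hq0.le
      have hr0 : 0 ≤ s % q := Int.emod_nonneg _ hq0.ne'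
      have hr1 : s % q < q := Int.emod_lt_of_pos _ hq0
      have hsq := Int.emod_add_mul_ediv s q
      generalize s / q = a at *
      generalize s % q = r at *
      have hb0 : 0 ≤ r / p := Int.ediv_nonneg hr0 (by linarith)
      have hc0 : 0 ≤ r % p := Int.emod_nonneg _ (by linarith)
      have hc1 : r % p < p := Int.emod_lt_of_pos _ (by linarith)
      have hrp := Int.emod_add_mul_ediv r p
      generalize r / p = b at *
      generalize r % p = c at *
      clear_value s T
      have ha1 : a ≤ p - 1 := by
        by_contra! h
        nlinarith
      have hb1 : b ≤ κ := by
        by_contra! h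
        nlinarith
      have hbc : b + c ≤ κ + p - 2 := by
        rcases hb1.lt_or_eq with h | rfl
        · linarith
        · nlinarith
      refine ⟨T, a, b, c, ha0, hb0, hc0, ?_, by linear_combination hsT + hsq + hrp⟩
      have hT0 : 2 * p + κ - 5 ≤ T := by
        by_contra! h
        nlinarith
      have hpar : ∃ t, T - (a + b + c) = 2 * t := by
        refine ⟨g - T * (2 * p' * q' + p' + q') + a * q' + b * p', ?_⟩
        have e : 2 * g = T * (p * q) - (a * q + b * p + c) := by
          linear_combination hsT + hsq + hrp
        rw [hp', hq'] at e
        linear_combination -e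
      by_contra! hcount
      have hTeq : T = 2 * p + κ - 5 := by omega
      have haeq : a = p - 1 := by omega
      have hbceq : b + c = κ + p - 2 := by omega
      have hslt : s < p * q - 1 - lam := by subst hTeq; linarith
      have hrlt : r < κ * p - 1 := by subst haeq; linarith
      rcases hb1.lt_or_eq with h | rfl
      · have hb : b = κ - 1 := by omega
        have hc : c = p - 1 := by omega
        subst hb hc
        linarith
      · linarith
    · by_contra! hlt
      obtain ⟨T, y, z, w, hy, hz, hw, hT, h⟩ := (hiff g0).1 (hfrob.2 g0 hlt)
      have hcoins := le_coins_of_change_eq (N := (T - (2 * p + κ - 5) + 1) * p) (y := y)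
        hdiv hlam1 hlam2 hq0 hκ hw hz (by linear_combination h - h2g0)
      have hk : 0 ≤ T - (2 * p + κ - 5) := by
        have h1 : 0 ≤ y * q := by positivity
        have h2 : 0 ≤ z * p := mul_nonneg hz (by linarith)
        by_contra! hneg
        nlinarith
      nlinarith
end

section
/- If p = 3, or if (p, q) is a twin prime pair (i.e., q = p + 2), then the Frobenius number g of {d0, d1, d2, d3} equals g2. -/
theorem IsFrob.unique {d0 d1 d2 d3 g h : ℤ} (hg : IsFrob d0 d1 d2 d3 g)
    (hh : IsFrob d0 d1 d2 d3 h) : g = h := by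
  rcases lt_trichotomy g h with hlt | heq | hgt
  · exact absurd (hg.2 h hlt) hh.1
  · exact heq
  · exact absurd (hh.2 g hgt) hg.1

/-- The Frobenius number of `{3q, q, 3(q-1)/2, (3q-1)/2}`. -/
theorem isFrob_three {q m κ lam G : ℤ} (hq : q = 2 * m + 1) (hq3 : 3 < q)
    (hdiv : q = κ * 3 + lam) (hlam1 : 1 ≤ lam) (hlam2 : lam ≤ 2)
    (hG : 2 * G = q * (3 * κ + 1) - (3 * κ - 1)) :
    IsFrob (3 * q) q (3 * m) (3 * m + 1) G := by
  constructor
  · rintro ⟨x, y, z, w, hx, hy, hz, hw, hn⟩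
    obtain ⟨t, ht⟩ : ∃ t, t = 6 * x + 2 * y + 3 * z + 3 * w - (3 * κ + 1) := ⟨_, rfl⟩
    have key : 3 * z + w = (3 * κ - 1) + q * t := by
      subst ht
      subst hq
      linear_combination 2 * hn - hG
    have ht0 : 0 ≤ t := by
      by_contra! h
      nlinarith
    have ht1 : t ≤ 0 := by
      by_contra! h
      nlinarith
    obtain rfl : t = 0 := le_antisymm ht1 ht0
    omega
  · intro n hn
    obtain ⟨k, hk⟩ : ∃ k, k = -((-2 * n) / q) := ⟨_, rfl⟩
    obtain ⟨s, hs⟩ : ∃ s, s = (-2 * n) % q := ⟨_, rfl⟩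
    have hs0 : 0 ≤ s := hs ▸ Int.emod_nonneg _ (by omega)
    have hsq : s < q := hs ▸ Int.emod_lt_of_pos _ (by omega)
    have hnk : 2 * n + s = q * k := by
      have := Int.mul_ediv_add_emod (-2 * n) q
      rw [← hs] at this
      subst hk
      linear_combination this
    have hpar : ∃ j, k - s = 2 * j := ⟨n - m * k, by subst hq; linear_combination -hnk⟩
    obtain ⟨j, hj⟩ := hpar
    have hle : s + 2 * (s % 3) ≤ k := by
      by_contra! hlt
      have hk2 : k ≤ s + 2 * (s % 3) - 2 := by omega
      have hmul : q * k ≤ q * (s + 2 * (s % 3) - 2) := by gcongr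
      have h3 : s % 3 = 0 ∨ s % 3 = 1 ∨ s % 3 = 2 := by omega
      rcases h3 with h | h | h <;> rw [h] at hmul
      · have : s ≤ 3 * κ + 1 := by omega
        nlinarith
      · have : s ≤ 3 * κ + 1 := by omega
        nlinarith
      · have : s ≤ 3 * κ - 1 := by omega
        nlinarith
    refine ⟨0, j - s % 3, s / 3, s % 3, le_rfl, by omega, by omega, by omega, ?_⟩
    have hs3 : 3 * (s / 3) + s % 3 = s := Int.mul_ediv_add_emod s 3
    subst hq
    have : 2 * n = 2 * ((j - s % 3) * (2 * m + 1) + s / 3 * (3 * m) + s % 3 * (3 * m + 1)) := by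
      linear_combination hnk + (2 * m + 1) * hj - 2 * m * hs3
    linarith

/-- For odd `p`, every `s < p * (p + 2)` is a sum of few parts `p + 2`, `p` and `1`. -/
theorem exists_few_parts {p p' s : ℤ} (hp : p = 2 * p' + 1) (h2p : 2 < p) (hs0 : 0 ≤ s)
    (hs : s < p * (p + 2)) :
    ∃ y z w : ℤ, 0 ≤ y ∧ 0 ≤ z ∧ 0 ≤ w ∧ s = (p + 2) * y + p * z + w ∧
      (y + z + w ≤ p ∨ y + z + w ≤ p + 1 ∧ p * (p + 1) ≤ s) := by
  obtain ⟨a, ha⟩ : ∃ a, a = s / p := ⟨_, rfl⟩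
  obtain ⟨r, hr⟩ : ∃ r, r = s % p := ⟨_, rfl⟩
  have hr0 : 0 ≤ r := hr ▸ Int.emod_nonneg _ (by omega)
  have hrp : r < p := hr ▸ Int.emod_lt_of_pos _ (by omega)
  have hsum : s = p * a + r := by
    rw [ha, hr, Int.mul_ediv_add_emod]
  have ha0 : 0 ≤ a := ha ▸ Int.ediv_nonneg hs0 (by omega)
  have hap : a ≤ p + 1 := by
    by_contra! h
    nlinarith
  rcases lt_or_ge (2 * a) r with hra | hra
  · exact ⟨a, 0, r - 2 * a, ha0, le_rfl, by omega, by rw [hsum]; ring, by left; omega⟩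
  rcases Int.even_or_odd' r with ⟨i, hi | hi⟩
  · refine ⟨i, a - i, 0, by omega, by omega, le_rfl, by rw [hsum, hi]; ring, ?_⟩
    rcases hap.lt_or_eq with h | h
    · left; omega
    · right
      refine ⟨by omega, ?_⟩
      rw [hsum, h]; omega
  rcases lt_or_ge a p with h | h
  · exact ⟨i, a - i, 1, by omega, by omega, by omega, by rw [hsum, hi]; ring, by left; omega⟩
  · refine ⟨p' + i + 1, a - 1 - (p' + i + 1), 0, by omega, by omega, le_rfl, ?_, by left; omega⟩
    rw [hsum, hi]
    linear_combination hp

/-- The Frobenius number when `q = p + 2`. -/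
theorem isFrob_twin {p p' d G : ℤ} (hp : p = 2 * p' + 1) (h2p : 2 < p)
    (hd : 2 * d = p * (p + 2) - 1) (hG : 2 * G = p * (p + 2) * (p - 1) - p * (p + 1)) :
    IsFrob (p * (p + 2)) (p' * (p + 2)) (p * (p' + 1)) d G := by
  constructor
  · rintro ⟨x, y, z, w, hx, hy, hz, hw, hn⟩
    obtain ⟨t, ht⟩ : ∃ t, t = 2 * x + y + z + w - (p - 1) := ⟨_, rfl⟩
    have key : (p + 2) * y + p * z + w = p * (p + 1) + p * (p + 2) * t := by
      subst ht
      linear_combination 2 * hn - hG + w * hd - ((p + 2) * y + p * z) * hp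
    have ht0 : 0 ≤ t := by
      by_contra! h
      have h1 : p * (p + 2) * t ≤ p * (p + 2) * (-1) := by gcongr; omega
      nlinarith [mul_nonneg (show 0 ≤ p + 2 by omega) hy, mul_nonneg (show 0 ≤ p by omega) hz]
    have hk : y + z + w ≤ p - 1 + t := by omega
    have h1 : (p + 2) * (y + z + w) ≤ (p + 2) * (p - 1 + t) := by gcongr
    have h2 : 0 ≤ (p + 1) * w := by positivity
    have h3 : 0 ≤ (p + 2) * (p - 1) * t :=
      mul_nonneg (mul_nonneg (by omega) (by omega)) ht0
    linarith
  · intro n hn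
    have hD : 0 < p * (p + 2) := by positivity
    obtain ⟨D, hDdef⟩ : ∃ D, D = p * (p + 2) := ⟨_, rfl⟩
    rw [← hDdef] at hD
    obtain ⟨k, hk⟩ : ∃ k, k = -((-2 * n) / D) := ⟨_, rfl⟩
    obtain ⟨s, hs⟩ : ∃ s, s = (-2 * n) % D := ⟨_, rfl⟩
    have hs0 : 0 ≤ s := hs ▸ Int.emod_nonneg _ (by omega)
    have hsD : s < D := hs ▸ Int.emod_lt_of_pos _ (by omega)
    have hnk : 2 * n + s = D * k := by
      have := Int.mul_ediv_add_emod (-2 * n) D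
      rw [← hs] at this
      subst hk
      linear_combination this
    obtain ⟨y, z, w, hy, hz, hw, hsyzw, hfew⟩ :=
      exists_few_parts hp h2p hs0 (hDdef ▸ hsD)
    obtain ⟨j, hj⟩ : ∃ j, k - (y + z + w) = 2 * j :=
      ⟨n - d * k + (p' + 1) * y + p' * z, by
        linear_combination -hnk - k * hDdef + k * hd + hsyzw + (y + z) * hp⟩
    have hj0 : 0 ≤ j := by
      by_contra! hlt
      rcases hfew with h | ⟨h, hsp⟩
      · have h1 : D * k ≤ D * (p - 2) := by gcongr; omega
        subst hDdef
        nlinarith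
      · have h1 : D * k ≤ D * (p - 1) := by gcongr; omega
        subst hDdef
        nlinarith
    refine ⟨j, y, z, w, hj0, hy, hz, hw, ?_⟩
    have : 2 * n = 2 * (j * (p * (p + 2)) + y * (p' * (p + 2)) + z * (p * (p' + 1)) + w * d) := by
      subst hDdef
      linear_combination hnk + p * (p + 2) * hj - hsyzw - w * hd + ((p + 2) * y + p * z) * hp
    linarith

theorem frobenius_eq_g2_of_three_or_twin
    (p q p' q' κ lam κ' lam' d0 d1 d2 d3 g0 g2 g : ℤ)
    (hp : Prime p) (hq : Prime q) (h2p : 2 < p) (hpq : p < q)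
    (hp' : p = 2 * p' + 1) (hq' : q = 2 * q' + 1)
    (hdiv : q = κ * p + lam) (hlam1 : 1 ≤ lam) (hlam2 : lam ≤ p - 1)
    (hdiv' : q' = κ' * p' + lam') (hlam'1 : 0 ≤ lam') (hlam'2 : lam' ≤ p' - 1)
    (hd0 : d0 = p * q) (hd1 : d1 = p' * q) (hd2 : d2 = p * q')
    (hd3 : 2 * d3 = p * q - 1)
    (hg0 : g0 = (p' - 1) * d0 + (p - 1) * d1 + κ * d2 - d3)
    (hg2 : g2 = g0 - (p - 3) * d3)
    (hfrob : IsFrob d0 d1 d2 d3 g)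
    (hcase : p = 3 ∨ q = p + 2) :
    g = g2 := by
  refine hfrob.unique ?_
  rcases hcase with rfl | rfl
  · obtain rfl : p' = 1 := by omega
    obtain rfl : d3 = 3 * q' + 1 := by omega
    rw [hd0, hd1, hd2, one_mul]
    refine isFrob_three hq' hpq hdiv hlam1 (by omega) ?_
    rw [hg2, hg0, hd1, hd2, hq']
    ring
  · obtain rfl : q' = p' + 1 := by omega
    have hκ : κ = 1 := by
      have h0 : 0 < κ := by
        by_contra! h
        nlinarith
      have h2 : κ < 2 := by
        by_contra! h
        nlinarith
      omega
    rw [hd0, hd1, hd2]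
    refine isFrob_twin hp' h2p hd3 ?_
    rw [hg2, hg0, hd0, hd1, hd2, hκ]
    linear_combination (-p + 2) * hd3 - ((p - 1) * (p + 2) + p * (p + 2) + p) * hp'
end

section
/- If q ≥ p*(p-3) + 3, then the Frobenius number g of {d0, d1, d2, d3} equals g0. -/
/-- Twice a combination of `d0, d1, d2, d3` is `S * (p * q)` minus an amount paid with at most `S`
coins of values `q`, `p` and `1`. -/
theorem representable_iff_exists_coins {p q p' q' d0 d1 d2 d3 n : ℤ}
    (hp' : p = 2 * p' + 1) (hq' : q = 2 * q' + 1)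
    (hd0 : d0 = p * q) (hd1 : d1 = p' * q) (hd2 : d2 = p * q') (hd3 : 2 * d3 = p * q - 1) :
    Representable d0 d1 d2 d3 n ↔ ∃ S y z w : ℤ, 0 ≤ y ∧ 0 ≤ z ∧ 0 ≤ w ∧ y + z + w ≤ S ∧
      2 * n = S * (p * q) - (y * q + z * p + w) := by
  have h1 : 2 * d1 = p * q - q := by rw [hd1, hp']; ring
  have h2 : 2 * d2 = p * q - p := by rw [hd2, hq']; ring
  constructor
  · rintro ⟨x, y, z, w, hx, hy, hz, hw, h⟩
    refine ⟨2 * x + y + z + w, y, z, w, hy, hz, hw, by linarith, ?_⟩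
    linear_combination 2 * h + 2 * x * hd0 + y * h1 + z * h2 + w * hd3
  · rintro ⟨S, y, z, w, hy, hz, hw, hS, h⟩
    have hpar : S - (y + z + w) = 2 * (n - S * (2 * p' * q' + p' + q') + y * q' + z * p') := by
      rw [hp', hq'] at h
      linear_combination -h
    set x := n - S * (2 * p' * q' + p' + q') + y * q' + z * p'
    refine ⟨x, y, z, w, by linarith, hy, hz, hw, ?_⟩
    have : 2 * n = 2 * (x * d0 + y * d1 + z * d2 + w * d3) := by
      linear_combination h - 2 * x * hd0 - y * h1 - z * h2 - w * hd3 + p * q * hpar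
    linarith

/-- Lower bound for the number of coins of values `q`, `p`, `1` needed to pay
`A * q + κ * p - 1`; the bound is attained by the greedy payment. -/
theorem coins_ge_of_eq {p q κ lam A y z w : ℤ} (hκ : 0 ≤ κ) (hdiv : q = κ * p + lam)
    (hlam1 : 1 ≤ lam) (hlam2 : lam ≤ p - 1) (hsum : p ≤ κ + lam)
    (hz : 0 ≤ z) (hw : 0 ≤ w)
    (h : y * q + z * p + w = A * q + κ * p - 1) :
    A + κ + p - 2 ≤ y + z + w := by
  have hp : 0 < p := by linarith
  have hq : 0 < q := by nlinarith
  have hyA : y ≤ A := by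
    by_contra! hlt
    nlinarith [mul_nonneg hz hp.le, mul_le_mul_of_nonneg_right (show A + 1 ≤ y from hlt) hq.le]
  obtain ⟨k, hk⟩ : ∃ k, k = A - y := ⟨_, rfl⟩
  obtain ⟨u, hu⟩ : ∃ u, u = z - (k * κ + κ - 1) := ⟨_, rfl⟩
  obtain rfl : y = A - k := by linarith
  obtain rfl : z = u + (k * κ + κ - 1) := by linarith
  have hk0 : 0 ≤ k := by linarith
  have hw' : w = k * lam + p - 1 - u * p := by
    rw [hdiv] at h
    linear_combination h
  have huk : u ≤ k := by
    by_contra! hlt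
    nlinarith [mul_le_mul_of_nonneg_right (show k + 1 ≤ u from hlt) hp.le,
      mul_le_mul_of_nonneg_left hlam2 hk0]
  have e1 : k * p ≤ k * (κ + lam) := mul_le_mul_of_nonneg_left hsum hk0
  have e2 : u * (p - 1) ≤ k * (p - 1) := mul_le_mul_of_nonneg_right huk (by linarith)
  rw [hw']
  linarith

/-- The greedy payment of an amount below `p * q` with coins of values `q`, `p`, `1` uses at most
`2 * p + κ - 3` coins, and fewer if the amount is less than `(p - 1) * q + κ * p - 1`. -/
theorem exists_coins_le {p q κ lam m : ℤ} (hp : 0 < p) (hq : 0 < q) (hdiv : q = κ * p + lam)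
    (hlam2 : lam ≤ p - 1) (hm0 : 0 ≤ m) (hm : m < p * q) :
    ∃ y z w : ℤ, 0 ≤ y ∧ 0 ≤ z ∧ 0 ≤ w ∧ m = y * q + z * p + w ∧ y + z + w ≤ 2 * p + κ - 3 ∧
      (y + z + w = 2 * p + κ - 3 → (p - 1) * q + κ * p - 1 ≤ m) := by
  have hr0 := Int.emod_nonneg m hq.ne'
  have hrq := Int.emod_lt_of_pos m hq
  have hm_eq := Int.mul_ediv_add_emod m q
  have ha0 := Int.ediv_nonneg hm0 hq.le
  have ha : m / q < p := Int.ediv_lt_of_lt_mul hq hm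
  generalize m % q = r at *
  generalize m / q = a at *
  have hc0 := Int.emod_nonneg r hp.ne'
  have hcp := Int.emod_lt_of_pos r hp
  have hr_eq := Int.mul_ediv_add_emod r p
  have hb0 := Int.ediv_nonneg hr0 hp.le
  generalize r % p = c at *
  generalize r / p = b at *
  have hb : b ≤ κ := by
    by_contra! hlt
    nlinarith [mul_le_mul_of_nonneg_left (show κ + 1 ≤ b from hlt) hp.le]
  have hbc : b = κ → c < lam := by
    rintro rfl
    linarith
  refine ⟨a, b, c, ha0, hb0, hc0, by linarith, ?_, ?_⟩
  · rcases hb.eq_or_lt with hb | hb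
    · have := hbc hb
      linarith
    · linarith
  · intro h
    rcases hb.eq_or_lt with hb | hb
    · have := hbc hb
      obtain rfl : a = p - 1 := by linarith
      subst hb
      linarith
    · obtain rfl : a = p - 1 := by linarith
      obtain rfl : b = κ - 1 := by linarith
      linarith

/-- For `q` large compared with `p ^ 2`, the greedy payment is optimal for the coin values
`q`, `p`, `1`. -/
theorem le_quotient_add_remainder {p q p' q' κ lam : ℤ} (h2p : 2 < p)
    (hp' : p = 2 * p' + 1) (hq' : q = 2 * q' + 1) (hdiv : q = κ * p + lam)
    (hlam1 : 1 ≤ lam) (hlam2 : lam ≤ p - 1) (hbig : p * (p - 3) + 3 ≤ q) :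
    p ≤ κ + lam := by
  by_contra! hlt
  have h3 : p - 3 ≤ κ := by
    by_contra! h
    nlinarith [mul_le_mul_of_nonneg_right (show κ ≤ p - 4 by linarith) (show 0 ≤ p by linarith)]
  obtain rfl | ⟨rfl, rfl⟩ : κ = p - 3 ∨ (κ = p - 2 ∧ lam = 1) := by omega
  · linarith
  · have : 2 * q' + 1 = 2 * (2 * p' * p') := by
      rw [← hq', hdiv, hp']
      ring
    omega

theorem frobenius_eq_g0_of_large_q
    (p q p' q' κ lam κ' lam' d0 d1 d2 d3 g0 g : ℤ)
    (hp : Prime p) (hq : Prime q) (h2p : 2 < p) (hpq : p < q)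
    (hp' : p = 2 * p' + 1) (hq' : q = 2 * q' + 1)
    (hdiv : q = κ * p + lam) (hlam1 : 1 ≤ lam) (hlam2 : lam ≤ p - 1)
    (hdiv' : q' = κ' * p' + lam') (hlam'1 : 0 ≤ lam') (hlam'2 : lam' ≤ p' - 1)
    (hd0 : d0 = p * q) (hd1 : d1 = p' * q) (hd2 : d2 = p * q')
    (hd3 : 2 * d3 = p * q - 1)
    (hg0 : g0 = (p' - 1) * d0 + (p - 1) * d1 + κ * d2 - d3)
    (hfrob : IsFrob d0 d1 d2 d3 g)
    (hbig : p * (p - 3) + 3 ≤ q) :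
    g = g0 := by
  have hp0 : 0 < p := by linarith
  have hq0 : 0 < q := by linarith
  have hpq0 : 0 < p * q := mul_pos hp0 hq0
  have hκ : 0 ≤ κ := by
    by_contra! h
    nlinarith [mul_le_mul_of_nonneg_right (show κ ≤ -1 by linarith) hp0.le]
  have hsum := le_quotient_add_remainder h2p hp' hq' hdiv hlam1 hlam2 hbig
  have h2g0 : 2 * g0 = (2 * p + κ - 5) * (p * q) - ((p - 1) * q + κ * p - 1) := by
    rw [hg0, hd0, hd1, hd2]
    linear_combination -hd3 - (p * q + (p - 1) * q) * hp' - κ * p * hq'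
  have hrep (n : ℤ) := representable_iff_exists_coins (n := n) hp' hq' hd0 hd1 hd2 hd3
  have hg0_not : ¬ Representable d0 d1 d2 d3 g0 := by
    rw [hrep]
    rintro ⟨S, y, z, w, hy, hz, hw, hS, h⟩
    obtain ⟨t, rfl⟩ : ∃ t, S = 2 * p + κ - 5 + t := ⟨S - (2 * p + κ - 5), by ring⟩
    have hcoins : y * q + z * p + w = (t * p + (p - 1)) * q + κ * p - 1 := by linarith
    have hge := coins_ge_of_eq hκ hdiv hlam1 hlam2 hsum hz hw hcoins
    have ht : 0 ≤ t := by
      by_contra! ht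
      nlinarith [mul_le_mul_of_nonneg_right (show t ≤ -1 by linarith) hpq0.le,
        mul_nonneg hy hq0.le, mul_nonneg hz hp0.le]
    nlinarith
  have hg0_lt (n : ℤ) (hn : g0 < n) : Representable d0 d1 d2 d3 n := by
    rw [hrep]
    have hm0 := Int.emod_nonneg (-(2 * n)) hpq0.ne'
    have hm := Int.emod_lt_of_pos (-(2 * n)) hpq0
    have hm_eq := Int.mul_ediv_add_emod (-(2 * n)) (p * q)
    generalize -(2 * n) % (p * q) = m at *
    obtain ⟨t, ht⟩ : ∃ t, -(-(2 * n) / (p * q)) = 2 * p + κ - 5 + t :=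
      ⟨-(-(2 * n) / (p * q)) - (2 * p + κ - 5), by ring⟩
    obtain ⟨y, z, w, hy, hz, hw, hm_coins, hle, hmax⟩ :=
      exists_coins_le hp0 hq0 hdiv hlam2 hm0 hm
    have h2n : 2 * n = (2 * p + κ - 5 + t) * (p * q) - m := by
      rw [← ht]
      linarith
    refine ⟨_, y, z, w, hy, hz, hw, ?_, hm_coins ▸ h2n⟩
    have hm_t : m < t * (p * q) + ((p - 1) * q + κ * p - 1) := by linarith
    have ht0 : 0 ≤ t := by
      by_contra! ht
      nlinarith [mul_le_mul_of_nonneg_right (show t ≤ -1 by linarith) hpq0.le]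
    have hpar : 2 * p + κ - 5 + t - (y + z + w) =
        2 * (n - (2 * p + κ - 5 + t) * (2 * p' * q' + p' + q') + y * q' + z * p') := by
      rw [hm_coins] at h2n
      generalize 2 * p + κ - 5 + t = S at *
      rw [hp', hq'] at h2n
      linear_combination -h2n
    generalize n - (2 * p + κ - 5 + t) * (2 * p' * q' + p' + q') + y * q' + z * p' = x at hpar
    rcases ht0.eq_or_lt with rfl | ht0
    · have hne : y + z + w ≠ 2 * p + κ - 3 := fun h => by linarith [hmax h]
      omega
    · omega
  rcases lt_trichotomy g g0 with h | h | h
  · exact absurd (hfrob.2 g0 h) hg0_not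
  · exact h
  · exact absurd (hg0_lt g h) hfrob.1
end

section
/- If κ + λ < p and the pair (p, q) is of Type II, then the Frobenius number g of {d0, d1, d2, d3} satisfies g1 ≤ g < g0. -/
/-- With `p`, `q` odd, `2 * n = p * q * N - S` where `S` is paid with `y`, `z`, `w` coins of values
`q`, `p`, `1`; by parity, using at most `N + 1` coins already forces at most `N`. -/
lemma representable_of_coins {p q p' q' d0 d1 d2 d3 n N y z w : ℤ}
    (hp' : p = 2 * p' + 1) (hq' : q = 2 * q' + 1)
    (hd0 : d0 = p * q) (hd1 : d1 = p' * q) (hd2 : d2 = p * q') (hd3 : 2 * d3 = p * q - 1)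
    (hy : 0 ≤ y) (hz : 0 ≤ z) (hw : 0 ≤ w) (hN : y + z + w ≤ N + 1)
    (hn : 2 * n = p * q * N - (y * q + z * p + w)) :
    Representable d0 d1 d2 d3 n := by
  have hx : 2 * (n - d3 * N + y * q' + z * p') = N - y - z - w := by
    linear_combination hn - N * hd3 - y * hq' - z * hp'
  refine ⟨n - d3 * N + y * q' + z * p', y, z, w, by omega, hy, hz, hw, ?_⟩
  have h1 : 2 * d1 = p * q - q := by rw [hd1]; linear_combination (-q) * hp'
  have h2 : 2 * d2 = p * q - p := by rw [hd2]; linear_combination (-p) * hq'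
  refine mul_left_cancel₀ (two_ne_zero (α := ℤ)) ?_
  rw [hd0]
  linear_combination hn - p * q * hx - y * h1 - z * h2 - w * hd3

/-- Every amount below `p * q` can be paid greedily with at most `2 * p + κ - 3` coins of values
`q`, `p`, `1`, and only `p * q - lam - 1` needs that many. -/
lemma exists_greedy_coins {p q κ lam s : ℤ} (hp : 0 < p) (hκ : 0 < κ) (hlam : 0 ≤ lam)
    (hdiv : q = κ * p + lam) (hkl : κ + lam < p) (hs0 : 0 ≤ s) (hs : s < p * q) :
    ∃ y z w : ℤ, 0 ≤ y ∧ 0 ≤ z ∧ 0 ≤ w ∧ s = y * q + z * p + w ∧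
      y + z + w ≤ 2 * p + κ - 3 ∧ (s ≠ p * q - lam - 1 → y + z + w ≤ 2 * p + κ - 4) := by
  have hq : 0 < q := by nlinarith
  have hr0 := Int.emod_nonneg s hq.ne'
  have hr1 := Int.emod_lt_of_pos s hq
  have hr := Int.mul_ediv_add_emod s q
  have hy0 : 0 ≤ s / q := Int.ediv_nonneg hs0 hq.le
  have hy1 : s / q < p := Int.ediv_lt_of_lt_mul hq hs
  generalize s / q = y at *
  generalize s % q = r at *
  have hw0 := Int.emod_nonneg r hp.ne'
  have hw1 := Int.emod_lt_of_pos r hp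
  have hw := Int.mul_ediv_add_emod r p
  have hz0 : 0 ≤ r / p := Int.ediv_nonneg hr0 hp.le
  generalize r / p = z at *
  generalize r % p = w at *
  have hz1 : z ≤ κ := by
    by_contra! h
    nlinarith
  refine ⟨y, z, w, hy0, hz0, hw0, by linarith, ?_⟩
  rcases hz1.lt_or_eq with h | h
  · refine ⟨by omega, fun hne => ?_⟩
    by_contra! hc
    obtain rfl : y = p - 1 := by omega
    obtain rfl : z = κ - 1 := by omega
    obtain rfl : w = p - 1 := by omega
    exact hne (by linarith)
  · subst h
    have : w < lam := by linarith
    exact ⟨by omega, fun _ => by omega⟩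

/-- An amount `(k + 1) * p * q - 2 * lam - 1` needs at least `2 * p - 3 + κ - lam + k` coins of
values `q`, `p`, `1`, provided `(t + 1) * (p - κ - lam) ≤ p - 1` for a `t` with
`p < (p - lam) * (t + 1)`. -/
lemma coins_lower_bound {p q κ lam t k y z w : ℤ} (hlam1 : 1 ≤ lam) (hlam2 : lam < p)
    (hdiv : q = κ * p + lam) (hκ : 0 < κ) (hkl : κ + lam < p) (ht : p < (p - lam) * (t + 1))
    (htm : (t + 1) * (p - κ - lam) ≤ p - 1) (hk : 0 ≤ k) (hz : 0 ≤ z) (hw : 0 ≤ w)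
    (hS : y * q + z * p + w = (k + 1) * (p * q) - 2 * lam - 1) :
    2 * p - 3 + κ - lam + k ≤ y + z + w := by
  have hq : 0 < q := by nlinarith
  obtain ⟨j, rfl⟩ : ∃ j, y = (k + 1) * p - 1 - j := ⟨(k + 1) * p - 1 - y, by ring⟩
  obtain ⟨a, rfl⟩ : ∃ a, z = (j + 1) * (κ + 1) - 2 - a := ⟨(j + 1) * (κ + 1) - 2 - z, by ring⟩
  have hwj : w = a * p - (j - 1) * (p - lam) - 1 := by
    rw [hdiv] at hS
    linear_combination hS
  have hj : 0 ≤ j := by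
    by_contra! h
    have h1 : 0 ≤ ((j + 1) * (κ + 1) - 2 - a) * p := mul_nonneg hz (by linarith)
    have h2 : (j + 1) * q ≤ 0 := mul_nonpos_of_nonpos_of_nonneg (by omega) hq.le
    linarith
  have ha : 0 ≤ a := by
    by_contra! h
    have h1 : a * p ≤ -1 * p := mul_le_mul_of_nonneg_right (by omega) (by omega)
    have h2 : 0 ≤ j * (p - lam) := mul_nonneg hj (by omega)
    linarith
  have hja : j ≤ a * (t + 1) := by
    by_contra! h
    have h1 : a * (t + 1) * (p - lam) ≤ (j - 1) * (p - lam) :=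
      mul_le_mul_of_nonneg_right (by omega) (by omega)
    have h2 : a * p ≤ a * ((p - lam) * (t + 1)) := mul_le_mul_of_nonneg_left ht.le ha
    linarith
  have h1 : j * (p - κ - lam) ≤ a * (t + 1) * (p - κ - lam) :=
    mul_le_mul_of_nonneg_right hja (by omega)
  have h2 : a * ((t + 1) * (p - κ - lam)) ≤ a * (p - 1) := mul_le_mul_of_nonneg_left htm ha
  have h3 : 0 ≤ k * (p - 1) := mul_nonneg hk (by omega)
  rw [hwj]
  linarith

theorem frobenius_typeII_bounds
    (p q p' q' κ lam κ' lam' τ d0 d1 d2 d3 g0 g1 g : ℤ)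
    (hp : Prime p) (hq : Prime q) (h2p : 2 < p) (hpq : p < q)
    (hp' : p = 2 * p' + 1) (hq' : q = 2 * q' + 1)
    (hdiv : q = κ * p + lam) (hlam1 : 1 ≤ lam) (hlam2 : lam ≤ p - 1)
    (hdiv' : q' = κ' * p' + lam') (hlam'1 : 0 ≤ lam') (hlam'2 : lam' ≤ p' - 1)
    (hd0 : d0 = p * q) (hd1 : d1 = p' * q) (hd2 : d2 = p * q')
    (hd3 : 2 * d3 = p * q - 1)
    (hg0 : g0 = (p' - 1) * d0 + (p - 1) * d1 + κ * d2 - d3)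
    (hg1 : g1 = g0 - lam * d3)
    (hfrob : IsFrob d0 d1 d2 d3 g)
    (hkl : κ + lam < p)
    (hτ : τ = lam / (p - lam))
    (hTypeII : (τ + 1) * p' ≤ (τ + 2) * lam') :
    g1 ≤ g ∧ g < g0 := by
  have hpp : 0 < p := by omega
  have hκ : 0 < κ := by
    by_contra! h
    nlinarith
  have hq0 : 0 < q := by omega
  have hpq0 : 0 < p * q := mul_pos hpp hq0
  have h2d1 : 2 * d1 = p * q - q := by rw [hd1]; linear_combination (-q) * hp'
  have h2d2 : 2 * d2 = p * q - p := by rw [hd2]; linear_combination (-p) * hq'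
  have h2g0 : 2 * g0 = p * q * (2 * p - 5 + κ) - (p * q - lam - 1) := by
    rw [hg0, hd0]
    linear_combination (p - 1) * h2d1 + κ * h2d2 - hd3 - p * q * hp' + hdiv
  have hrem : 2 * lam' = κ + lam - 1 := by
    have h : 2 * p' * (κ' - κ) = κ + lam - 1 - 2 * lam' := by
      linear_combination hdiv - 2 * hdiv' - hq' + κ * hp'
    have h1 : κ' - κ < 1 := by
      by_contra! h1
      nlinarith
    have h2 : -1 < κ' - κ := by
      by_contra! h1
      nlinarith
    have h3 : κ' - κ = 0 := by omega
    rw [h3] at h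
    linarith
  constructor
  · by_contra! hlt
    obtain ⟨x, y, z, w, hx, hy, hz, hw, hn⟩ := hfrob.2 g1 hlt
    have h2g1 : 2 * g1 = p * q * (2 * p - 5 + κ - lam) - (p * q - 2 * lam - 1) := by
      linear_combination 2 * hg1 + h2g0 - lam * hd3
    obtain ⟨k, hk⟩ : ∃ k, k = 2 * x + y + z + w - (2 * p - 5 + κ - lam) := ⟨_, rfl⟩
    have hS : y * q + z * p + w = (k + 1) * (p * q) - 2 * lam - 1 := by
      rw [hk]
      rw [hd0] at hn
      linear_combination 2 * hn - h2g1 + y * h2d1 + z * h2d2 + w * hd3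
    have hk0 : 0 ≤ k := by
      by_contra! h
      have h1 : (k + 1) * (p * q) ≤ 0 := mul_nonpos_of_nonpos_of_nonneg (by omega) hpq0.le
      have h2 : 0 ≤ y * q := mul_nonneg hy hq0.le
      have h3 : 0 ≤ z * p := mul_nonneg hz hpp.le
      linarith
    have hτlt : lam < (τ + 1) * (p - lam) := by
      rw [hτ]
      exact Int.lt_ediv_add_one_mul_self lam (by omega)
    have := coins_lower_bound (t := τ + 1) hlam1 (by omega) hdiv hκ hkl (by linarith)
      (by nlinarith) hk0 hz hw hS
    omega
  · by_contra! hge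
    refine hfrob.1 ?_
    have hs0 := Int.emod_nonneg (-2 * g) hpq0.ne'
    have hs1 := Int.emod_lt_of_pos (-2 * g) hpq0
    have hs := Int.mul_ediv_add_emod (-2 * g) (p * q)
    generalize -2 * g % (p * q) = s at *
    obtain ⟨N, hN⟩ : ∃ N, N = -(-2 * g / (p * q)) := ⟨_, rfl⟩
    have h2g : 2 * g = p * q * N - s := by
      rw [hN]
      linear_combination hs
    have hNlt {M : ℤ} (h : p * q * M < p * q * N) : M < N := lt_of_mul_lt_mul_left h hpq0.le
    by_cases hsS : s = p * q - lam - 1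
    · have : 2 * p - 6 + κ < N := hNlt (by linarith)
      refine representable_of_coins (N := N) (y := p - 2) (z := 2 * κ) (w := lam - 1) hp' hq' hd0
        hd1 hd2 hd3 (by omega) (by omega) (by omega) (by omega) ?_
      linear_combination h2g - hsS - 2 * hdiv
    · obtain ⟨y, z, w, hy, hz, hw, hsum, hle, hlt⟩ :=
        exists_greedy_coins hpp hκ (by omega) hdiv hkl hs0 hs1
      refine representable_of_coins (N := N) hp' hq' hd0 hd1 hd2 hd3 hy hz hw ?_ (hsum ▸ h2g)
      have := hlt hsS
      have : 2 * p - 6 + κ < N := hNlt (by linarith)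
      omega
end

section
/- Every integer strictly greater than g0 is representable, i.e., for every integer n > g0 there exist nonnegative integers x, y, z, w with n = x*d0 + y*d1 + z*d2 + w*d3. -/
/-- The greedy expansion of `N < p * q` in coins `q, p, 1` uses at most `2 * p + κ - 3` coins, and
strictly fewer when `N < (p - 1) * q + κ * p - 1`. -/
theorem exists_greedy_expansion {p q κ lam N : ℤ} (hp : 0 < p) (hpq : p < q)
    (hdiv : q = κ * p + lam) (hlam : lam ≤ p - 1) (hN0 : 0 ≤ N) (hN : N < p * q) :
    ∃ y z w : ℤ, 0 ≤ y ∧ 0 ≤ z ∧ 0 ≤ w ∧ N = y * q + z * p + w ∧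
      y + z + w ≤ 2 * p + κ - 3 ∧
      (N < (p - 1) * q + κ * p - 1 → y + z + w < 2 * p + κ - 3) := by
  have hq : 0 < q := hp.trans hpq
  obtain ⟨y, r, hy, hr0, hrq, hNr⟩ : ∃ y r : ℤ, 0 ≤ y ∧ 0 ≤ r ∧ r < q ∧ N = y * q + r :=
    ⟨N / q, N % q, Int.ediv_nonneg hN0 hq.le, Int.emod_nonneg _ hq.ne', Int.emod_lt_of_pos _ hq,
      (Int.ediv_mul_add_emod N q).symm⟩
  obtain ⟨z, w, hz, hw0, hwp, hrw⟩ : ∃ z w : ℤ, 0 ≤ z ∧ 0 ≤ w ∧ w < p ∧ r = z * p + w :=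
    ⟨r / p, r % p, Int.ediv_nonneg hr0 hp.le, Int.emod_nonneg _ hp.ne', Int.emod_lt_of_pos _ hp,
      (Int.ediv_mul_add_emod r p).symm⟩
  have hyp : y < p := by
    by_contra! h
    nlinarith
  have hzκ : z < κ + 1 := by
    by_contra! h
    nlinarith
  have hzw : z + w ≤ κ + p - 2 := by
    rcases (Int.lt_add_one_iff.mp hzκ).eq_or_lt with rfl | h
    · linarith
    · omega
  refine ⟨y, z, w, hy, hz, hw0, by rw [hNr, hrw]; ring, by omega, fun hlt => ?_⟩
  by_contra! h
  obtain rfl : y = p - 1 := by omega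
  rcases (Int.lt_add_one_iff.mp hzκ).eq_or_lt with rfl | h'
  · linarith
  · obtain rfl : z = κ - 1 := by omega
    nlinarith

theorem representable_of_gt_g0
    (p q p' q' κ lam κ' lam' d0 d1 d2 d3 g0 : ℤ)
    (hp : Prime p) (hq : Prime q) (h2p : 2 < p) (hpq : p < q)
    (hp' : p = 2 * p' + 1) (hq' : q = 2 * q' + 1)
    (hdiv : q = κ * p + lam) (hlam1 : 1 ≤ lam) (hlam2 : lam ≤ p - 1)
    (hdiv' : q' = κ' * p' + lam') (hlam'1 : 0 ≤ lam') (hlam'2 : lam' ≤ p' - 1)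
    (hd0 : d0 = p * q) (hd1 : d1 = p' * q) (hd2 : d2 = p * q')
    (hd3 : 2 * d3 = p * q - 1)
    (hg0 : g0 = (p' - 1) * d0 + (p - 1) * d1 + κ * d2 - d3) :
    ∀ n : ℤ, g0 < n → Representable d0 d1 d2 d3 n := by
  intro n hn
  have hp0 : 0 < p := by omega
  have hq0 : 0 < q := by omega
  have hd : 0 < p * q := mul_pos hp0 hq0
  obtain ⟨m, N, hN0, hNlt, hmN⟩ : ∃ m N : ℤ, 0 ≤ N ∧ N < p * q ∧ m * (p * q) = 2 * n + N :=
    ⟨-(-(2 * n) / (p * q)), -(2 * n) % (p * q), Int.emod_nonneg _ hd.ne',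
      Int.emod_lt_of_pos _ hd, by linarith [Int.ediv_mul_add_emod (-(2 * n)) (p * q)]⟩
  obtain ⟨y, z, w, hy, hz, hw, hyzw, hle, hlt⟩ :=
    exists_greedy_expansion hp0 hpq hdiv hlam2 hN0 hNlt
  have hg : 2 * g0 = (2 * p + κ - 5) * (p * q) - ((p - 1) * q + κ * p - 1) := by
    subst hg0 hd0 hd1 hd2
    have ha : 2 * p' = p - 1 := by omega
    have hb : 2 * q' = q - 1 := by omega
    linear_combination (p * q + (p - 1) * q) * ha + κ * p * hb - hd3
  have hm : 2 * p + κ - 5 ≤ m := by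
    by_contra! h
    have : (m + 1) * (p * q) ≤ (2 * p + κ - 5) * (p * q) :=
      mul_le_mul_of_nonneg_right (by omega) hd.le
    nlinarith
  have hx : m - y - z - w = 2 * (y * q' + z * p' + n - m * d3) := by
    linear_combination hmN + hyzw + m * hd3 + y * hq' + z * hp'
  refine ⟨y * q' + z * p' + n - m * d3, y, z, w, ?_, hy, hz, hw, ?_⟩
  · rcases hm.eq_or_lt with rfl | h
    · have := hlt (by linarith)
      omega
    · omega
  · have key : 2 * n = (m - y - z - w) * (p * q) + y * ((p - 1) * q) + z * (p * (q - 1))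
        + w * (p * q - 1) := by
      linear_combination -hmN - hyzw
    rw [hx, ← hd3] at key
    subst hd0 hd1 hd2
    have ha : p - 1 = 2 * p' := by omega
    have hb : q - 1 = 2 * q' := by omega
    rw [ha, hb] at key
    linarith
end

section
/- Let t be an integer with 0 ≤ t ≤ d1 - 1, and write t = a*q' + b*p' + c where a = ⌊t/q'⌋, b = ⌊(t - a*q')/p'⌋, and c = t - a*q' - b*p' (so a ≥ 0 is maximal, b ≥ 0, and 0 ≤ c ≤ p'-1). Then: (i) a ≤ p-1; (ii) if a = p-1 then b = 0; (iii) b ≤ κ'; (iv) if b = κ' then c < λ' and p > 3; (v) if b ≥ κ then a ≤ p-2. -/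
theorem division_data_lemma
    (p q p' q' κ lam κ' lam' d1 t a b c : ℤ)
    (hp : Prime p) (hq : Prime q) (h2p : 2 < p) (hpq : p < q)
    (hp' : p = 2 * p' + 1) (hq' : q = 2 * q' + 1)
    (hdiv : q = κ * p + lam) (hlam1 : 1 ≤ lam) (hlam2 : lam ≤ p - 1)
    (hdiv' : q' = κ' * p' + lam') (hlam'1 : 0 ≤ lam') (hlam'2 : lam' ≤ p' - 1)
    (hd1 : d1 = p' * q)
    (ht0 : 0 ≤ t) (ht1 : t ≤ d1 - 1)
    (ha : a = t / q')
    (hb : b = (t - a * q') / p')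
    (hc : c = t - a * q' - b * p') :
    a ≤ p - 1 ∧
    (a = p - 1 → b = 0) ∧
    b ≤ κ' ∧
    (b = κ' → c < lam' ∧ 3 < p) ∧
    (κ ≤ b → a ≤ p - 2) := by
  have hp'_pos : 0 < p' := by lia
  have hq'_pos : 0 < q' := by lia
  have hr0 : 0 ≤ t - a * q' := by
    have := Int.ediv_mul_le t hq'_pos.ne'
    rw [← ha] at this
    lia
  have hr1 : t - a * q' < q' := by
    have := Int.lt_ediv_add_one_mul_self t hq'_pos
    rw [← ha] at this
    linarith
  have hc0 : 0 ≤ c := by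
    have := Int.ediv_mul_le (t - a * q') hp'_pos.ne'
    rw [← hb] at this
    lia
  have hd1' : d1 = (p - 1) * q' + p' := by
    rw [hd1, hq', hp']
    ring
  have hap : a ≤ p - 1 := by
    by_contra! h
    nlinarith
  have hb0 : a = p - 1 → b = 0 := by
    intro h
    rw [hb]
    subst h
    exact Int.ediv_eq_zero_of_lt hr0 (by linarith)
  have hκ : 0 < κ := by
    by_contra! h
    nlinarith
  refine ⟨hap, hb0, ?_, ?_, ?_⟩
  · by_contra! h
    nlinarith
  · intro h
    have hcl : c < lam' := by
      rw [hc, h]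
      linarith
    exact ⟨hcl, by lia⟩
  · intro h
    have : a ≠ p - 1 := fun h' => by
      have := hb0 h'
      lia
    lia
end

section
/- The integer g0 is representable (i.e., g0 = x*d0 + y*d1 + z*d2 + w*d3 for some nonnegative integers x, y, z, w) if and only if κ + λ < p. -/
theorem g0_representable_iff
    (p q p' q' κ lam κ' lam' d0 d1 d2 d3 g0 : ℤ)
    (hp : Prime p) (hq : Prime q) (h2p : 2 < p) (hpq : p < q)
    (hp' : p = 2 * p' + 1) (hq' : q = 2 * q' + 1)
    (hdiv : q = κ * p + lam) (hlam1 : 1 ≤ lam) (hlam2 : lam ≤ p - 1)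
    (hdiv' : q' = κ' * p' + lam') (hlam'1 : 0 ≤ lam') (hlam'2 : lam' ≤ p' - 1)
    (hd0 : d0 = p * q) (hd1 : d1 = p' * q) (hd2 : d2 = p * q')
    (hd3 : 2 * d3 = p * q - 1)
    (hg0 : g0 = (p' - 1) * d0 + (p - 1) * d1 + κ * d2 - d3) :
    Representable d0 d1 d2 d3 g0 ↔ κ + lam < p := by
  have hκ : 0 ≤ κ := by
    by_contra! h
    nlinarith
  have hd1' : 2 * d1 = p * q - q := by rw [hd1, hp']; ring
  have hd2' : 2 * d2 = p * q - p := by rw [hd2, hq']; ring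
  have hg : 2 * g0 = (2 * p - 5 + κ) * (p * q) - (p - 1) * q - κ * p + 1 := by
    linear_combination 2 * hg0 + 2 * (p' - 1) * hd0 + (p - 1) * hd1' + κ * hd2' - hd3 -
      p * q * hp'
  constructor
  · rintro ⟨x, y, z, w, hx, hy, hz, hw, h⟩
    by_contra! hle
    obtain ⟨T, hT⟩ : ∃ T, T = 2 * x + y + z + w - 2 * p + 6 - κ := ⟨_, rfl⟩
    have key : y * q + z * p + w = T * (p * q) - lam - 1 := by
      linear_combination 2 * h - hg + 2 * x * hd0 + y * hd1' + z * hd2' + w * hd3 -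
        p * q * hT - hdiv
    have hT1 : 1 ≤ T := by
      by_contra! hT0
      have h1 : 0 ≤ y * q := mul_nonneg hy (by linarith)
      have h2 : 0 ≤ z * p := mul_nonneg hz (by linarith)
      have h3 : T * (p * q) ≤ 0 :=
        mul_nonpos_of_nonpos_of_nonneg (by linarith) (mul_nonneg (by linarith) (by linarith))
      linarith
    obtain ⟨j, hj⟩ : ∃ j, j = T * p - 1 - y := ⟨_, rfl⟩
    have hj0 : 0 ≤ j := by
      by_contra! hlt
      have h2 : 0 ≤ z * p := mul_nonneg hz (by linarith)
      have h3 : T * p * q ≤ y * q := mul_le_mul_of_nonneg_right (by linarith) (by linarith)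
      linarith
    obtain ⟨e, he⟩ : ∃ e, e = z - (j + 1) * κ := ⟨_, rfl⟩
    have hwe : w = j * lam - 1 - e * p := by
      linear_combination key - q * hj + p * he + (j + 1) * hdiv
    have hej : e ≤ j - 1 := by
      by_contra! hlt
      have h1 : j * p ≤ e * p := mul_le_mul_of_nonneg_right (by linarith) (by linarith)
      have h2 : j * lam ≤ j * p := mul_le_mul_of_nonneg_left (by linarith) hj0
      linarith
    have h1 : j * p ≤ j * (κ + lam) := mul_le_mul_of_nonneg_left hle hj0
    have h2 : e * (p - 1) ≤ (j - 1) * (p - 1) := mul_le_mul_of_nonneg_right hej (by linarith)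
    have h3 : 1 * (p - 1) ≤ T * (p - 1) := mul_le_mul_of_nonneg_right hT1 (by linarith)
    linarith
  · intro hlt
    have hx : 2 * (p' - 1 - q' + κ * p') = p - 2 - κ - lam := by
      linear_combination hq' - hdiv - (κ + 1) * hp'
    refine ⟨p' - 1 - q' + κ * p', p - 2, 2 * κ, lam - 1, by omega, by linarith, by linarith,
      by linarith, ?_⟩
    have h2 : (2 : ℤ) ≠ 0 := two_ne_zero
    apply mul_left_cancel₀ h2
    linear_combination hg - 2 * (p' - 1 - q' + κ * p') * hd0 - (p - 2) * hd1' -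
      2 * κ * hd2' - (lam - 1) * hd3 - p * q * hx - hdiv
end

section
/- If (x0, y0, z0, w0) and (x, y, z, w) are quadruples of integers such that x0*d0 + y0*d1 + z0*d2 + w0*d3 = x*d0 + y*d1 + z*d2 + w*d3, then there exists an integer l such that x0*p + (y0 + w0)*p' - l*q' = x*p + (y + w)*p' and z0*p + w0 + l*q = z*p + w. -/
theorem rep_system
    (p q p' q' d0 d1 d2 d3 x0 y0 z0 w0 x y z w : ℤ)
    (hp : Prime p) (hq : Prime q) (h2p : 2 < p) (hpq : p < q)
    (hp' : p = 2 * p' + 1) (hq' : q = 2 * q' + 1)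
    (hd0 : d0 = p * q) (hd1 : d1 = p' * q) (hd2 : d2 = p * q')
    (hd3 : 2 * d3 = p * q - 1)
    (heq : x0 * d0 + y0 * d1 + z0 * d2 + w0 * d3
         = x * d0 + y * d1 + z * d2 + w * d3) :
    ∃ l : ℤ,
      x0 * p + (y0 + w0) * p' - l * q' = x * p + (y + w) * p' ∧
      z0 * p + w0 + l * q = z * p + w := by
  have hd3' : d3 = p' * q + q' := by
    have h : 2 * d3 = 2 * (p' * q + q') := by
      rw [hd3, hp', hq']; ring
    linarith
  subst hd3' hd0 hd1 hd2 hp' hq'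
  refine ⟨-((z0 - z) * (2 * p' + 1) + (w0 - w))
    - 2 * ((x0 - x) * (2 * p' + 1) + (y0 - y + (w0 - w)) * p'), ?_, ?_⟩
  · linear_combination heq
  · linear_combination -2 * heq
end

section
/- If κ + λ ≤ p - λ, then every integer strictly greater than g1 is representable, i.e., for every integer n > g1 there exist nonnegative integers x, y, z, w with n = x*d0 + y*d1 + z*d2 + w*d3. -/
/-- Every `s` below `p * q` is a sum of few coins of values `q`, `p` and `1`, and one coin fewer
suffices unless `s` is close to `p * q`. -/
theorem exists_few_coins {p q κ l s : ℤ} (hq : q = κ * p + l) (hl : 1 ≤ l) (hκ : 1 ≤ κ)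
    (hkl : κ + l ≤ p - l) (hs0 : 0 ≤ s) (hs : s < p * q) :
    ∃ y z w : ℤ, 0 ≤ y ∧ 0 ≤ z ∧ 0 ≤ w ∧ y * q + z * p + w = s ∧
      y + z + w ≤ 2 * p - 3 + κ - l ∧
      (s ≤ p * q - 2 * l - 3 → y + z + w ≤ 2 * p - 4 + κ - l) := by
  have hp0 : 0 < p := by linarith
  have hq0 : 0 < q := by rw [hq]; positivity
  obtain ⟨a, r, ha0, hap, hr0, hrq, rfl⟩ :
      ∃ a r : ℤ, 0 ≤ a ∧ a < p ∧ 0 ≤ r ∧ r < q ∧ s = a * q + r :=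
    ⟨s / q, s % q, Int.ediv_nonneg hs0 hq0.le, Int.ediv_lt_of_lt_mul hq0 hs,
      Int.emod_nonneg _ hq0.ne', Int.emod_lt_of_pos _ hq0, (Int.ediv_mul_add_emod s q).symm⟩
  obtain ⟨b, c, hb0, hc0, hcp, rfl⟩ : ∃ b c : ℤ, 0 ≤ b ∧ 0 ≤ c ∧ c < p ∧ r = b * p + c :=
    ⟨r / p, r % p, Int.ediv_nonneg hr0 hp0.le, Int.emod_nonneg _ hp0.ne',
      Int.emod_lt_of_pos _ hp0, (Int.ediv_mul_add_emod r p).symm⟩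
  have hbκ : b ≤ κ := by
    by_contra! h
    nlinarith
  have hcl : b = κ → c < l := by
    rintro rfl
    linarith
  have hc_near : a = p - 1 → b = κ - 1 → a * q + (b * p + c) ≤ p * q - 2 * l - 3 →
      c ≤ p - l - 3 := by
    rintro rfl rfl h
    rw [hq] at h
    linarith
  have hc_top : a = p - 1 → b = κ → ¬ a * q + (b * p + c) ≤ p * q - 2 * l - 3 := by
    rintro rfl rfl h
    rw [hq] at h
    linarith
  by_cases h : 1 ≤ a ∧ p - l ≤ c
  · refine ⟨a - 1, κ + b + 1, c + l - p, by omega, by omega, by omega, ?_, by omega, ?_⟩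
    · rw [hq]; ring
    · intro hs'
      have := fun h₁ h₂ ↦ hc_near h₁ h₂ hs'
      omega
  · refine ⟨a, b, c, ha0, hb0, hc0, by ring, by omega, ?_⟩
    intro hs'
    have := fun h₁ h₂ ↦ hc_near h₁ h₂ hs'
    have := fun h₁ h₂ ↦ hc_top h₁ h₂ hs'
    omega

theorem representable_of_gt_g1
    (p q p' q' κ lam κ' lam' d0 d1 d2 d3 g0 g1 : ℤ)
    (hp : Prime p) (hq : Prime q) (h2p : 2 < p) (hpq : p < q)
    (hp' : p = 2 * p' + 1) (hq' : q = 2 * q' + 1)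
    (hdiv : q = κ * p + lam) (hlam1 : 1 ≤ lam) (hlam2 : lam ≤ p - 1)
    (hdiv' : q' = κ' * p' + lam') (hlam'1 : 0 ≤ lam') (hlam'2 : lam' ≤ p' - 1)
    (hd0 : d0 = p * q) (hd1 : d1 = p' * q) (hd2 : d2 = p * q')
    (hd3 : 2 * d3 = p * q - 1)
    (hg0 : g0 = (p' - 1) * d0 + (p - 1) * d1 + κ * d2 - d3)
    (hg1 : g1 = g0 - lam * d3)
    (hkl : κ + lam ≤ p - lam) :
    ∀ n : ℤ, g1 < n → Representable d0 d1 d2 d3 n := by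
  intro n hn
  have hp0 : 0 < p := by linarith
  have hq0 : 0 < q := by linarith
  have hκ : 1 ≤ κ := by
    by_contra! h
    nlinarith
  have hpq0 : 0 < p * q := mul_pos hp0 hq0
  have h1 : 2 * d1 = p * q - q := by rw [hd1]; linear_combination -q * hp'
  have h2 : 2 * d2 = p * q - p := by rw [hd2]; linear_combination -p * hq'
  have hN : p * q * (2 * p - 6 + κ - lam) + 2 * lam + 3 ≤ 2 * n := by
    have : 2 * g1 = p * q * (2 * p - 6 + κ - lam) + 2 * lam + 1 := by
      rw [hg1, hg0, hd0]
      linear_combination (p - 1) * h1 + κ * h2 - (1 + lam) * hd3 - p * q * hp' + hdiv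
    linarith
  obtain ⟨t, s, hs0, hs, hts⟩ : ∃ t s : ℤ, 0 ≤ s ∧ s < p * q ∧ 2 * n = t * (p * q) - s :=
    ⟨-(-(2 * n) / (p * q)), -(2 * n) % (p * q), Int.emod_nonneg _ hpq0.ne',
      Int.emod_lt_of_pos _ hpq0, by linarith [Int.ediv_mul_add_emod (-(2 * n)) (p * q)]⟩
  obtain ⟨y, z, w, hy, hz, hw, hsum, hle, hle'⟩ :=
    exists_few_coins hdiv hlam1 hκ hkl hs0 hs
  have ht : 2 * p - 6 + κ - lam < t := by
    by_contra! h
    nlinarith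
  have hle₁ : t = 2 * p - 5 + κ - lam → y + z + w ≤ t + 1 := by
    intro h
    have := hle' (by rw [h] at hts; linarith)
    linarith
  have hparity : Even (t - (y + z + w)) := by
    refine ⟨n - t * (2 * p' * q' + p' + q') + y * q' + z * p', ?_⟩
    rw [hp', hq'] at hts hsum
    linear_combination -hts - hsum
  obtain ⟨x, hx⟩ := hparity
  refine ⟨x, y, z, w, by omega, hy, hz, hw, ?_⟩
  have : 2 * n = 2 * (x * d0 + y * d1 + z * d2 + w * d3) := by
    rw [hd0]
    linear_combination hts + p * q * hx - y * h1 - z * h2 - w * hd3 + hsum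
  linarith
end

section
/- If κ + λ < p, then: (i) κ = κ'; (ii) 2*λ' = κ + λ - 1 and λ' ≥ 1; (iii) p'*λ < p*λ' (i.e., p'/λ' < p/λ). -/
theorem prelims_lemma
    (p q p' q' κ lam κ' lam' : ℤ)
    (hp : Prime p) (hq : Prime q) (h2p : 2 < p) (hpq : p < q)
    (hp' : p = 2 * p' + 1) (hq' : q = 2 * q' + 1)
    (hdiv : q = κ * p + lam) (hlam1 : 1 ≤ lam) (hlam2 : lam ≤ p - 1)
    (hdiv' : q' = κ' * p' + lam') (hlam'1 : 0 ≤ lam') (hlam'2 : lam' ≤ p' - 1)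
    (hkl : κ + lam < p) :
    κ = κ' ∧ 2 * lam' = κ + lam - 1 ∧ 1 ≤ lam' ∧ p' * lam < p * lam' := by
  have hp0 : 0 < p' := by linarith
  have hκ : 1 ≤ κ := by
    by_contra! h
    nlinarith
  have heven : 2 * (q' - κ * p') = κ + lam - 1 := by
    subst hp'
    linarith
  have hκκ' : κ = κ' := by
    have hrem : p' * (κ - κ') = lam' - (q' - κ * p') := by
      rw [hdiv']
      ring
    apply le_antisymm
    · by_contra! h
      nlinarith
    · by_contra! h
      nlinarith
  have hlam' : 2 * lam' = κ + lam - 1 := by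
    rw [← heven, hdiv', hκκ']
    ring
  refine ⟨hκκ', hlam', by omega, ?_⟩
  nlinarith [mul_nonneg (by linarith : 0 ≤ p) (sub_nonneg.mpr hκ)]
end

section
/- Assume κ + λ < p. Then g1 is representable (i.e., g1 = x*d0 + y*d1 + z*d2 + w*d3 for some nonnegative integers x, y, z, w) if and only if the pair (p, q) is of Type I. -/
/-- Halving an odd `q = κ * p + lam` with `κ + lam < p`: the quotient of `q'` by `p'` is still `κ`,
and the remainder `lam'` satisfies `κ + lam = 2 * lam' + 1`. -/
lemma add_eq_two_mul_half_remainder_add_one {p' q' κ lam κ' lam' : ℤ}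
    (hdiv : 2 * q' + 1 = κ * (2 * p' + 1) + lam)
    (hdiv' : q' = κ' * p' + lam') (h0 : 0 ≤ lam') (h1 : lam' ≤ p' - 1)
    (hpos : 0 < κ + lam) (hkl : κ + lam < 2 * p' + 1) :
    κ + lam = 2 * lam' + 1 := by
  have key : 2 * p' * (κ - κ') = 2 * lam' + 1 - (κ + lam) := by
    subst hdiv'; linarith
  have hlt : κ - κ' < 1 := by
    by_contra! h
    nlinarith
  have hgt : -1 < κ - κ' := by
    by_contra! h
    nlinarith
  have : κ - κ' = 0 := by omega
  rw [this] at key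
  linarith

/-- Strict form of the floor inequality for `lam / (p - lam)` when `p` is prime. -/
lemma Prime.mul_lt_div_add_one_mul {p lam τ : ℤ} (hp : Prime p) (h1 : 1 ≤ lam)
    (h2 : lam + 2 ≤ p) (hτ0 : 0 ≤ τ) (hτ : τ * (p - lam) ≤ lam) :
    τ * p < (τ + 1) * lam := by
  refine lt_of_le_of_ne (by linarith) fun h => ?_
  have hdvd : p ∣ (τ + 1) * lam := ⟨τ, by linarith⟩
  rcases hp.dvd_or_dvd hdvd with h' | h'
  · have := Int.le_of_dvd (by linarith) h'
    nlinarith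
  · have := Int.le_of_dvd (by linarith) h'
    linarith

/-- If `(b + 1) / (e + 1) < p' / lam'` for some `b`, `e` with `e * p < b * lam`, then the same bound
holds for `b = τ + 1`, `e = τ`, where `τ = ⌊lam / (p - lam)⌋`. -/
lemma add_two_mul_lt_of_mul_lt {p p' lam lam' τ b e : ℤ} (hp' : 0 < p') (hlam' : 0 ≤ lam')
    (hlam0 : 0 ≤ lam) (hlam : lam < p) (hτ0 : 0 ≤ τ) (hτ : lam < (τ + 1) * (p - lam)) (hb : -1 ≤ b)
    (he : e * p < b * lam) (h : (b + 1) * lam' < (e + 1) * p') :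
    (τ + 2) * lam' < (τ + 1) * p' := by
  have he0 : 0 ≤ e := by
    by_contra! hneg
    nlinarith [mul_nonneg (by linarith : 0 ≤ b + 1) hlam']
  have hlt : e * (p - lam) < (b - e) * lam := by linarith
  have hc : 1 ≤ b - e := by
    by_contra! hc
    have hbe : b ≤ e := by omega
    nlinarith [mul_nonneg he0 (by linarith : 0 ≤ p - lam)]
  have hlt2 : e < (τ + 1) * (b - e) := by
    have : e * (p - lam) < (τ + 1) * (b - e) * (p - lam) := by nlinarith
    exact lt_of_mul_lt_mul_right this (by linarith)
  have hfrac : (τ + 2) * (e + 1) ≤ (τ + 1) * (b + 1) := by linarith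
  have : (e + 1) * ((τ + 2) * lam') < (e + 1) * ((τ + 1) * p') := by
    nlinarith [mul_le_mul_of_nonneg_right hfrac hlam',
      mul_lt_mul_of_pos_left h (by linarith : 0 < τ + 1)]
  exact lt_of_mul_lt_mul_left this (by linarith)

theorem g1_representable_iff_typeI
    (p q p' q' κ lam κ' lam' τ d0 d1 d2 d3 g0 g1 : ℤ)
    (hp : Prime p) (hq : Prime q) (h2p : 2 < p) (hpq : p < q)
    (hp' : p = 2 * p' + 1) (hq' : q = 2 * q' + 1)
    (hdiv : q = κ * p + lam) (hlam1 : 1 ≤ lam) (hlam2 : lam ≤ p - 1)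
    (hdiv' : q' = κ' * p' + lam') (hlam'1 : 0 ≤ lam') (hlam'2 : lam' ≤ p' - 1)
    (hd0 : d0 = p * q) (hd1 : d1 = p' * q) (hd2 : d2 = p * q')
    (hd3 : 2 * d3 = p * q - 1)
    (hg0 : g0 = (p' - 1) * d0 + (p - 1) * d1 + κ * d2 - d3)
    (hg1 : g1 = g0 - lam * d3)
    (hkl : κ + lam < p)
    (hτ : τ = lam / (p - lam)) :
    Representable d0 d1 d2 d3 g1 ↔ (τ + 2) * lam' < (τ + 1) * p' := by
  have hκ : 1 ≤ κ := by
    by_contra! h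
    nlinarith
  have hsum : κ + lam = 2 * lam' + 1 :=
    add_eq_two_mul_half_remainder_add_one (by rw [← hq', ← hp', hdiv]) hdiv' hlam'1 hlam'2
      (by linarith) (by linarith)
  have hpl : 0 < p - lam := by linarith
  have hτ0 : 0 ≤ τ := hτ ▸ Int.ediv_nonneg (by linarith) hpl.le
  have hτle : τ * (p - lam) ≤ lam := hτ ▸ Int.ediv_mul_le _ hpl.ne'
  have hτlt : lam < (τ + 1) * (p - lam) := hτ ▸ Int.lt_ediv_add_one_mul_self _ hpl
  have h2d2 : 2 * d2 = p * q - p := by rw [hd2, hq']; ring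
  have h2d1 : 2 * d1 = p * q - q := by rw [hd1, hp']; ring
  have h2g1 : 2 * g1 = p * q * (2 * p + κ - lam - 6) + (2 * lam + 1) := by
    rw [hg1, hg0, hd0]
    linear_combination (p - 1) * h2d1 + κ * h2d2 - (1 + lam) * hd3 - p * q * hp' + hdiv
  constructor
  · rintro ⟨x, y, z, w, hx, hy, hz, hw, hn⟩
    obtain ⟨j, hj⟩ : ∃ j, j = 2 * x + y + z + w - (2 * p + κ - lam - 6) := ⟨_, rfl⟩
    have hT : j * (p * q) - (2 * lam + 1) = y * q + z * p + w := by
      rw [hj]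
      linear_combination -2 * hn + h2g1 - 2 * x * hd0 - y * h2d1 - z * h2d2 - w * hd3
    have hq0 : 0 < q := by linarith
    have hj1 : 1 ≤ j := by
      by_contra! h
      have hj0 : 0 ≤ -j := by omega
      linarith [mul_nonneg hj0 (mul_pos (by linarith : 0 < p) hq0).le, mul_nonneg hy hq0.le,
        mul_nonneg hz (by linarith : 0 ≤ p)]
    obtain ⟨b, hb⟩ : ∃ b, b = j * p - y - 2 := ⟨_, rfl⟩
    obtain ⟨e, he⟩ : ∃ e, e = z - (b + 2) * κ := ⟨_, rfl⟩
    have hw' : w = b * lam - 1 - e * p := by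
      subst he
      have hy' : y = j * p - b - 2 := by linarith
      subst hy'
      linear_combination -hT + (b + 2) * hdiv
    have hb1 : -1 ≤ b := by
      by_contra! h
      have hb2 : 0 ≤ y - j * p := by omega
      linarith [mul_nonneg hz (by linarith : 0 ≤ p), mul_nonneg hb2 hq0.le]
    have hle : (b + 2) * (κ - 1) + e + w ≤ 2 * p + κ - lam - 6 - j * (p - 1) := by linarith
    have hj2 : j = 1 := by
      by_contra hne
      have hj2 : 2 ≤ j := by omega
      have hew : 0 ≤ e + w := by
        by_cases he0 : 0 ≤ e
        · linarith
        · have : e ≤ -1 := by omega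
          linarith [mul_nonneg (by linarith : 0 ≤ b + 1) (by linarith : 0 ≤ lam),
            mul_nonneg (by linarith : 0 ≤ -1 - e) (by linarith : 0 ≤ p - 1)]
      linarith [mul_nonneg (by linarith : 0 ≤ b + 1) (by linarith : 0 ≤ κ - 1),
        mul_nonneg (by linarith : 0 ≤ j - 2) (by linarith : 0 ≤ p - 1)]
    subst hj2
    refine add_two_mul_lt_of_mul_lt (p := p) (lam := lam) (b := b) (e := e) (by linarith) hlam'1
      (by linarith) (by linarith) hτ0 hτlt hb1 (by linarith) ?_
    have hκ' : κ = 2 * lam' + 1 - lam := by linarith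
    subst hκ' hw' hp'
    linarith
  · intro h
    have hw := hp.mul_lt_div_add_one_mul hlam1 (by linarith) hτ0 hτle
    refine ⟨(τ + 1) * p' - (τ + 2) * lam' - 1, p - τ - 3, (τ + 3) * κ + τ,
      (τ + 1) * lam - 1 - τ * p, by linarith, by nlinarith, by positivity, by linarith, ?_⟩
    have h2 : 2 * g1 = 2 * (((τ + 1) * p' - (τ + 2) * lam' - 1) * d0 + (p - τ - 3) * d1
        + ((τ + 3) * κ + τ) * d2 + ((τ + 1) * lam - 1 - τ * p) * d3) := by
      linear_combination h2g1 - 2 * ((τ + 1) * p' - (τ + 2) * lam' - 1) * hd0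
        - (p - τ - 3) * h2d1 - ((τ + 3) * κ + τ) * h2d2 - ((τ + 1) * lam - 1 - τ * p) * hd3
        + p * q * ((τ + 1) * hp' - (τ + 2) * hsum) - (τ + 3) * hdiv
    linarith
end

section
/- If κ + λ < p, the pair (p, q) is of Type II, and κ + λ > p - λ, then g1 + λ' is not representable (i.e., there do not exist nonnegative integers x, y, z, w with g1 + λ' = x*d0 + y*d1 + z*d2 + w*d3); consequently the Frobenius number of {d0, d1, d2, d3} is strictly greater than g1. -/
/-- Division of `q = 2 q' + 1` by `p = 2 p' + 1` determines the division of `q'` by `p'`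
when quotient plus remainder is small. -/
theorem two_mul_half_remainder_add_one {p q p' q' κ lam κ' lam' : ℤ}
    (hp' : p = 2 * p' + 1) (hq' : q = 2 * q' + 1) (hdiv : q = κ * p + lam)
    (hdiv' : q' = κ' * p' + lam') (h0 : 0 < κ + lam) (h1 : κ + lam < p)
    (hlam'1 : 0 ≤ lam') (hlam'2 : lam' ≤ p' - 1) : 2 * lam' + 1 = κ + lam := by
  have key : (κ' - κ) * (2 * p') = κ + lam - 1 - 2 * lam' := by
    subst hp' hq' hdiv'
    linear_combination hdiv
  have hlt : κ' - κ < 1 := by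
    by_contra! h
    nlinarith
  have hgt : -1 < κ' - κ := by
    by_contra! h
    nlinarith
  have h : κ' - κ = 0 := by omega
  rw [h] at key
  omega

/-- A lower bound for the number of coins in a representation of `k * (p * q) - (3 * lam + κ)`
by coins of values `q`, `p` and `1`. -/
theorem lt_card_coins {p q κ lam τ k y z w : ℤ} (hκ : 0 < κ) (hlam : 1 ≤ lam)
    (hq : q = κ * p + lam) (hkl : κ + lam < p) (hkl2 : p - lam < κ + lam)
    (hτ : lam < (τ + 1) * (p - lam))
    (hII : (τ + 2) * (p - lam - κ) ≤ p - 1)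
    (hy : 0 ≤ y) (hz : 0 ≤ z) (hw : 0 ≤ w)
    (h : y * q + z * p + w = k * (p * q) - (3 * lam + κ)) :
    2 * p + κ - 6 - lam + k < y + z + w := by
  have hp : 0 < p := by omega
  have hq0 : 0 < q := by rw [hq]; positivity
  have hk : 1 ≤ k := by
    have h1 : 0 < k * (p * q) := by nlinarith [mul_nonneg hy hq0.le, mul_nonneg hz hp.le]
    exact pos_of_mul_pos_left h1 (by positivity)
  obtain ⟨j, hj⟩ : ∃ j, j = k * p - y := ⟨_, rfl⟩
  have hjq : j * q = z * p + w + (3 * lam + κ) := by rw [hj]; linear_combination -h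
  have hj1 : 1 ≤ j := by
    have h1 : 0 < j * q := by nlinarith [mul_nonneg hz hp.le]
    exact pos_of_mul_pos_left h1 hq0.le
  obtain ⟨m, hm⟩ : ∃ m, m = j * κ + j - 3 - z := ⟨_, rfl⟩
  have hwm : w = m * p - (j - 3) * (p - lam) - κ := by
    rw [hm]
    rw [hq] at hjq
    linear_combination -hjq
  have hm0 : 0 ≤ m := by
    have h1 : -1 < m := by
      by_contra! h1
      nlinarith
    omega
  have main : (j - 2) * (p - lam - κ) ≤ m * (p - 1) := by
    rcases le_or_gt j 2 with hj2 | hj2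
    · nlinarith [mul_nonneg hm0 (show 0 ≤ p - 1 by omega)]
    · have hμ : 0 < p - lam := by omega
      have hlt : j - 3 < m * (τ + 2) := by
        by_contra! h1
        nlinarith [mul_le_mul_of_nonneg_right h1 hμ.le,
          mul_nonneg hm0 (show 0 ≤ (τ + 1) * (p - lam) - lam by omega)]
      nlinarith [mul_le_mul_of_nonneg_right (show j - 2 ≤ m * (τ + 2) by omega)
        (show 0 ≤ p - lam - κ by omega), mul_le_mul_of_nonneg_left hII hm0]
  have hkp : 0 ≤ (k - 1) * (p - 1) := mul_nonneg (by omega) (by omega)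
  have hy' : y = k * p - j := by omega
  have hz' : z = j * κ + j - 3 - m := by omega
  rw [hwm, hy', hz']
  linarith

theorem typeII_g1_plus_lam'_not_representable
    (p q p' q' κ lam κ' lam' τ d0 d1 d2 d3 g0 g1 : ℤ)
    (hp : Prime p) (hq : Prime q) (h2p : 2 < p) (hpq : p < q)
    (hp' : p = 2 * p' + 1) (hq' : q = 2 * q' + 1)
    (hdiv : q = κ * p + lam) (hlam1 : 1 ≤ lam) (hlam2 : lam ≤ p - 1)
    (hdiv' : q' = κ' * p' + lam') (hlam'1 : 0 ≤ lam') (hlam'2 : lam' ≤ p' - 1)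
    (hd0 : d0 = p * q) (hd1 : d1 = p' * q) (hd2 : d2 = p * q')
    (hd3 : 2 * d3 = p * q - 1)
    (hg0 : g0 = (p' - 1) * d0 + (p - 1) * d1 + κ * d2 - d3)
    (hg1 : g1 = g0 - lam * d3)
    (hkl : κ + lam < p)
    (hτ : τ = lam / (p - lam))
    (hTypeII : (τ + 1) * p' ≤ (τ + 2) * lam')
    (hkl2 : p - lam < κ + lam) :
    ¬ Representable d0 d1 d2 d3 (g1 + lam') ∧
      ∀ g : ℤ, IsFrob d0 d1 d2 d3 g → g1 < g := by
  have hκ : 0 < κ := by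
    by_contra! h
    nlinarith
  have hlam' : 2 * lam' + 1 = κ + lam :=
    two_mul_half_remainder_add_one hp' hq' hdiv hdiv' (by omega) hkl hlam'1 hlam'2
  have hμ : 0 < p - lam := by omega
  have hτ1 : lam < (τ + 1) * (p - lam) := hτ ▸ Int.lt_ediv_add_one_mul_self lam hμ
  have hII : (τ + 2) * (p - lam - κ) ≤ p - 1 := by
    have h1 : lam' * 2 = κ + lam - 1 := by omega
    have h2 : p' * 2 = p - 1 := by omega
    have h3 : (τ + 1) * (p - 1) ≤ (τ + 2) * (κ + lam - 1) := by
      rw [← h1, ← h2]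
      linarith
    linarith
  have hnot : ¬ Representable d0 d1 d2 d3 (g1 + lam') := by
    rintro ⟨x, y, z, w, hx, hy, hz, hw, h⟩
    have h1 : 2 * d1 = p * q - q := by rw [hd1, hp']; ring
    have h2 : 2 * d2 = p * q - p := by rw [hd2, hq']; ring
    have hg : 2 * (g1 + lam') = (2 * p + κ - 6 - lam) * (p * q) + (3 * lam + κ) := by
      rw [hg1, hg0, hd0]
      linear_combination (p - 1) * h1 + κ * h2 - (1 + lam) * hd3 + hlam' + hdiv - p * q * hp'
    have hc : y * q + z * p + w =
        (2 * x + y + z + w - (2 * p + κ - 6 - lam)) * (p * q) - (3 * lam + κ) := by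
      rw [hd0] at h
      linear_combination 2 * h - hg + y * h1 + z * h2 + w * hd3
    have := lt_card_coins hκ hlam1 hdiv hkl hkl2 hτ1 hII hy hz hw hc
    omega
  refine ⟨hnot, fun g hg => ?_⟩
  by_contra! hle
  exact hnot (hg.2 _ (by omega))
end

section
/- If κ + λ < p, then g2 is not representable; that is, there do not exist nonnegative integers x, y, z, w with g2 = x*d0 + y*d1 + z*d2 + w*d3. -/
theorem g2_not_representable
    (p q p' q' κ lam κ' lam' d0 d1 d2 d3 g0 g2 : ℤ)
    (hp : Prime p) (hq : Prime q) (h2p : 2 < p) (hpq : p < q)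
    (hp' : p = 2 * p' + 1) (hq' : q = 2 * q' + 1)
    (hdiv : q = κ * p + lam) (hlam1 : 1 ≤ lam) (hlam2 : lam ≤ p - 1)
    (hdiv' : q' = κ' * p' + lam') (hlam'1 : 0 ≤ lam') (hlam'2 : lam' ≤ p' - 1)
    (hd0 : d0 = p * q) (hd1 : d1 = p' * q) (hd2 : d2 = p * q')
    (hd3 : 2 * d3 = p * q - 1)
    (hg0 : g0 = (p' - 1) * d0 + (p - 1) * d1 + κ * d2 - d3)
    (hg2 : g2 = g0 - (p - 3) * d3)
    (hkl : κ + lam < p) :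
    ¬ Representable d0 d1 d2 d3 g2 := by
  rintro ⟨x, y, z, w, hx, hy, hz, hw, hn⟩
  have hκ : 0 < κ := by
    have : 0 < κ * p := by linarith
    exact pos_of_mul_pos_left this (by linarith)
  obtain ⟨t, ht⟩ : ∃ t, t = 2 * x + y + z + w - (p + κ - 3) := ⟨_, rfl⟩
  -- Doubling the representation and eliminating `x` leaves an identity in `y, z, w, t`.
  have hkey : y * q + z * p + w = p * q * t - (lam + p - 2) := by
    have h1 : 2 * d1 = (p - 1) * q := by rw [hd1, hp']; ring
    have h2 : 2 * d2 = p * (q - 1) := by rw [hd2, hq']; ring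
    rw [hg2, hg0, hd0] at hn
    rw [ht]
    linear_combination 2 * hn + (y - p + 1) * h1 + (z - κ) * h2 + (w + p - 2) * hd3 - hdiv + p * q * hp'
  have ht1 : 1 ≤ t := by
    have hpq0 : 0 < p * q := mul_pos (by linarith) (by linarith)
    have hyq : 0 ≤ y * q := mul_nonneg hy (by linarith)
    have hzp : 0 ≤ z * p := mul_nonneg hz (by linarith)
    have : 0 < p * q * t := by linarith
    exact pos_of_mul_pos_right this hpq0.le
  obtain ⟨j, hj⟩ : ∃ j, j = p * t - 1 - y := ⟨_, rfl⟩
  have hrest : z * p + w = j * q + (κ - 1) * p + 2 := by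
    rw [hj]
    linear_combination hkey + hdiv
  have hj0 : 0 ≤ j := by
    have hzp : 0 ≤ z * p := mul_nonneg hz (by linarith)
    have : 0 < (j + 1) * q := by linarith
    have := pos_of_mul_pos_left this (by linarith)
    linarith
  have hzw : j * κ + κ - 1 < z + w := by
    have h1 : w ≤ w * p := le_mul_of_one_le_right hw (by linarith)
    have h2 : 0 ≤ j * lam := mul_nonneg hj0 (by linarith)
    have h3 : j * q = j * κ * p + j * lam := by rw [hdiv]; ring
    refine lt_of_mul_lt_mul_right (a := p) ?_ (by linarith)
    linarith
  have h4 : j ≤ j * κ := le_mul_of_one_le_right hj0 hκ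
  have h5 : 0 ≤ (p - 1) * (t - 1) := mul_nonneg (by linarith) (by linarith)
  linarith
end

section
/- If (p, q) is a twin prime pair (q = p + 2), then every integer strictly greater than g2 is representable, i.e., for every integer n > g2 there exist nonnegative integers x, y, z, w with n = x*d0 + y*d1 + z*d2 + w*d3. -/
/-- Every integer from `2 * k * a` on, with `a = k * (2 * k + 3)`, lies in the semigroup generated
by `2 * a + 2 * k + 3`, `a`, `a + 1` and `a + k + 1`. -/
lemma representable_of_two_mul_mul_le {k a n : ℤ} (hk : 1 ≤ k) (ha : a = k * (2 * k + 3))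
    (hn : 2 * k * a ≤ n) : Representable (2 * a + 2 * k + 3) a (a + 1) (a + k + 1) n := by
  have ha0 : 0 < a := by rw [ha]; positivity
  obtain ⟨m, r, hnr, hr0, hra⟩ : ∃ m r : ℤ, n = a * m + r ∧ 0 ≤ r ∧ r < a :=
    ⟨n / a, n % a, (Int.mul_ediv_add_emod n a).symm, Int.emod_nonneg _ ha0.ne',
      Int.emod_lt_of_pos _ ha0⟩
  have hm : 2 * k ≤ m := by
    by_contra! h
    nlinarith
  obtain ⟨u, t, hut, ht0, htk⟩ : ∃ u t : ℤ, r = (k + 1) * u + t ∧ 0 ≤ t ∧ t < k + 1 :=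
    ⟨r / (k + 1), r % (k + 1), (Int.mul_ediv_add_emod r (k + 1)).symm,
      Int.emod_nonneg _ (by lia), Int.emod_lt_of_pos _ (by lia)⟩
  have hu0 : 0 ≤ u := by
    by_contra! h
    nlinarith
  have hu : u ≤ 2 * k := by
    by_contra! h
    nlinarith
  -- `x` copies of the largest generator, at most half of `u`, absorb as much of `t` as possible.
  obtain ⟨x, hx0, hxt, hxu, hxm⟩ :
      ∃ x : ℤ, 0 ≤ x ∧ x ≤ t ∧ 2 * x ≤ u ∧ u + (t - x) ≤ 2 * k := by
    rcases le_total t (u / 2) with h | h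
    · exact ⟨t, by lia, by lia, by lia, by lia⟩
    · exact ⟨u / 2, by lia, by lia, by lia, by lia⟩
  refine ⟨x, m - u - (t - x), t - x, u - 2 * x, hx0, by lia, by lia, by lia, ?_⟩
  rw [hnr, hut]
  ring

theorem twin_representable_of_gt_g2
    (p q p' q' κ lam κ' lam' d0 d1 d2 d3 g0 g2 : ℤ)
    (hp : Prime p) (hq : Prime q) (h2p : 2 < p) (hpq : p < q)
    (hp' : p = 2 * p' + 1) (hq' : q = 2 * q' + 1)
    (hdiv : q = κ * p + lam) (hlam1 : 1 ≤ lam) (hlam2 : lam ≤ p - 1)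
    (hdiv' : q' = κ' * p' + lam') (hlam'1 : 0 ≤ lam') (hlam'2 : lam' ≤ p' - 1)
    (hd0 : d0 = p * q) (hd1 : d1 = p' * q) (hd2 : d2 = p * q')
    (hd3 : 2 * d3 = p * q - 1)
    (hg0 : g0 = (p' - 1) * d0 + (p - 1) * d1 + κ * d2 - d3)
    (hg2 : g2 = g0 - (p - 3) * d3)
    (htwin : q = p + 2) :
    ∀ n : ℤ, g2 < n → Representable d0 d1 d2 d3 n := by
  intro n hn
  have hk : 1 ≤ p' := by lia
  have hκ : κ = 1 := by
    have hlow : 0 < κ := by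
      by_contra! h
      nlinarith
    have hupp : κ < 2 := by
      by_contra! h
      nlinarith
    lia
  have hq'' : q' = p' + 1 := by lia
  have hd1' : d1 = p' * (2 * p' + 3) := by rw [hd1, htwin, hp']; ring
  have hd2' : d2 = d1 + 1 := by rw [hd2, hd1', hq'', hp']; ring
  have hd3' : d3 = d1 + p' + 1 := by
    have h : 2 * d3 = 2 * (d1 + p' + 1) := by rw [hd3, hd1', htwin, hp']; ring
    lia
  have hd0' : d0 = 2 * d1 + 2 * p' + 3 := by rw [hd0, hd1', htwin, hp']; ring
  have hg : g2 = 2 * p' * d1 - 1 := by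
    rw [hg2, hg0, hd0', hd2', hd3', hκ, hp']; ring
  rw [hd0', hd2', hd3']
  exact representable_of_two_mul_mul_le hk hd1' (by lia)
end

section
/- Let (p, q) be a twin prime pair (q = p + 2) with p > 3, and let N = (p-1)*d1 + d2. Then N has no admissible representation (there are no nonnegative integers x, y, z, w with N = x*d0 + y*d1 + z*d2 + w*d3, y + w ≠ 1, z + w ≠ 1, x + y + w ≠ 0, and x + z + w ≠ 0), while every integer n > N does have an admissible representation. (Hence the largest non-genus of a Z_{pq} action is N - pq + 1.) -/
/-- `n` has an admissible representation: a nonnegative representation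
satisfying the admissibility conditions for a `ℤ_{pq}` action. -/
def AdmRep (d0 d1 d2 d3 n : ℤ) : Prop :=
  ∃ x y z w : ℤ, 0 ≤ x ∧ 0 ≤ y ∧ 0 ≤ z ∧ 0 ≤ w ∧
    n = x * d0 + y * d1 + z * d2 + w * d3 ∧
    y + w ≠ 1 ∧ z + w ≠ 1 ∧ x + y + w ≠ 0 ∧ x + z + w ≠ 0

/-- With the degrees of a twin pair `(2m+1, 2m+3)`, a representation of total weight `k` (counting
`x` twice) exceeds `k * d1` by `z + (m+1) w + (2m+3) x`. -/
theorem admRep_twin_of_weight {m n k r x y z w : ℤ} (hx : 0 ≤ x) (hy : 0 ≤ y) (hz : 0 ≤ z)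
    (hw : 0 ≤ w) (hn : n = k * (m * (2 * m + 3)) + r) (hk : k = 2 * x + y + z + w)
    (hr : r = z + (m + 1) * w + (2 * m + 3) * x)
    (hyw : y + w ≠ 1) (hzw : z + w ≠ 1) (hxyw : x + y + w ≠ 0) (hxzw : x + z + w ≠ 0) :
    AdmRep ((2 * m + 1) * (2 * m + 3)) (m * (2 * m + 3)) ((2 * m + 1) * (m + 1))
      (2 * m ^ 2 + 4 * m + 1) n :=
  ⟨x, y, z, w, hx, hy, hz, hw, by rw [hn, hk, hr]; ring, hyw, hzw, hxyw, hxzw⟩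

theorem not_admRep_twin {m : ℤ} (hm : 1 ≤ m) :
    ¬ AdmRep ((2 * m + 1) * (2 * m + 3)) (m * (2 * m + 3)) ((2 * m + 1) * (m + 1))
      (2 * m ^ 2 + 4 * m + 1) ((2 * m + 1) * (m * (2 * m + 3)) + 1) := by
  rintro ⟨x, y, z, w, hx, hy, hz, hw, hn, -, hzw, -, -⟩
  obtain ⟨k, hk⟩ : ∃ k, k = 2 * x + y + z + w := ⟨_, rfl⟩
  obtain ⟨r, hr⟩ : ∃ r, r = z + (m + 1) * w + (2 * m + 3) * x := ⟨_, rfl⟩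
  have hkr : k * (m * (2 * m + 3)) + r = (2 * m + 1) * (m * (2 * m + 3)) + 1 := by
    rw [hn, hk, hr]; ring
  have hmw : 0 ≤ m * w := by positivity
  have hmx : 0 ≤ m * x := by positivity
  have hmy : 0 ≤ m * y := by positivity
  have hmz : 0 ≤ m * z := by positivity
  have hr0 : 0 ≤ r := by rw [hr]; nlinarith
  have hr_le : 2 * r ≤ (2 * m + 3) * k := by rw [hr, hk]; nlinarith
  have hk_le : k ≤ 2 * m + 1 := by
    by_contra! h
    nlinarith [mul_le_mul_of_nonneg_right (Int.add_one_le_iff.mpr h)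
      (show 0 ≤ m * (2 * m + 3) by positivity)]
  have hk_ge : 2 * m + 1 ≤ k := by
    by_contra! h
    have h1 : (2 * m + 3) * ((2 * m + 1) * (2 * m + 1 - k) - (2 * m + 1)) + 2 ≤ 0 := by
      linarith
    have h2 : 0 ≤ (2 * m + 3) * ((2 * m + 1) * (2 * m - k)) :=
      mul_nonneg (by linarith) (mul_nonneg (by linarith) (by linarith))
    linarith
  obtain rfl : k = 2 * m + 1 := le_antisymm hk_le hk_ge
  have hr1 : r = 1 := by linarith
  have hx0 : x = 0 := by nlinarith
  have hw0 : w = 0 := by nlinarith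
  subst hx0 hw0
  apply hzw
  linarith

theorem admRep_twin_of_lt {m n : ℤ} (hm : 2 ≤ m)
    (hn : (2 * m + 1) * (m * (2 * m + 3)) + 1 < n) :
    AdmRep ((2 * m + 1) * (2 * m + 3)) (m * (2 * m + 3)) ((2 * m + 1) * (m + 1))
      (2 * m ^ 2 + 4 * m + 1) n := by
  have ha : 0 < m * (2 * m + 3) := by positivity
  obtain ⟨k, r, hnk, hr0, hra⟩ :
      ∃ k r, n = k * (m * (2 * m + 3)) + r ∧ 0 ≤ r ∧ r < m * (2 * m + 3) :=
    ⟨n / (m * (2 * m + 3)), n % (m * (2 * m + 3)), (Int.ediv_mul_add_emod _ _).symm,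
      Int.emod_nonneg _ ha.ne', Int.emod_lt_of_pos _ ha⟩
  have hk : 2 * m + 1 ≤ k := by
    by_contra! h
    nlinarith [mul_le_mul_of_nonneg_right (Int.add_one_le_iff.mpr h) ha.le]
  have hk' : r ≤ 1 → 2 * m + 2 ≤ k := by
    intro hr
    by_contra! h
    obtain rfl : k = 2 * m + 1 := by omega
    linarith
  obtain ⟨t, s, hrt, hs0, hsm⟩ : ∃ t s, r = t * (m + 1) + s ∧ 0 ≤ s ∧ s < m + 1 :=
    ⟨r / (m + 1), r % (m + 1), (Int.ediv_mul_add_emod _ _).symm,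
      Int.emod_nonneg _ (by omega), Int.emod_lt_of_pos _ (by omega)⟩
  have ht0 : 0 ≤ t := by
    by_contra! h
    nlinarith
  have ht : t ≤ 2 * m := by
    by_contra! h
    nlinarith [mul_le_mul_of_nonneg_right (Int.add_one_le_iff.mpr h)
      (show 0 ≤ m + 1 by positivity)]
  rcases (show t = 0 ∨ t = 1 ∨ 2 ≤ t by omega) with rfl | rfl | ht2
  · rcases (show s = 0 ∨ s = 1 ∨ 2 ≤ s by omega) with rfl | rfl | hs2
    · have := hk' (by omega)
      exact admRep_twin_of_weight (k := k - 1) (r := m * (2 * m + 3)) (x := m - 1)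
        (y := k - 2 * m - 2) (z := 1) (w := 2) (by omega) (by omega) (by omega) (by omega)
        (by rw [hnk, hrt]; ring) (by ring) (by ring) (by omega) (by omega) (by omega) (by omega)
    · have := hk' (by omega)
      exact admRep_twin_of_weight (k := k - 1) (r := m * (2 * m + 3) + 1) (x := 0)
        (y := k - 2 * m - 2) (z := 0) (w := 2 * m + 1) (by omega) (by omega) (by omega)
        (by omega) (by rw [hnk, hrt]; ring) (by ring) (by ring) (by omega) (by omega) (by omega)
        (by omega)
    · exact admRep_twin_of_weight (x := 0) (y := k - s) (z := s) (w := 0) (by omega) (by omega)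
        (by omega) (by omega) hnk (by ring) (by rw [hrt]; ring) (by omega) (by omega) (by omega)
        (by omega)
  · rcases hs0.eq_or_lt with rfl | hs1
    · exact admRep_twin_of_weight (x := 0) (y := k - m - 1) (z := m + 1) (w := 0) (by omega)
        (by omega) (by omega) (by omega) hnk (by ring) (by rw [hrt]; ring) (by omega) (by omega)
        (by omega) (by omega)
    · exact admRep_twin_of_weight (x := 0) (y := k - 1 - s) (z := s) (w := 1) (by omega)
        (by omega) (by omega) (by omega) hnk (by ring) (by rw [hrt]; ring) (by omega) (by omega)
        (by omega) (by omega)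
  · obtain ⟨x, hx⟩ : ∃ x, x = min s (t / 2 - 1) := ⟨_, rfl⟩
    exact admRep_twin_of_weight (x := x) (y := k - t - (s - x)) (z := s - x) (w := t - 2 * x)
      (by omega) (by omega) (by omega) (by omega) hnk (by ring) (by rw [hrt]; ring) (by omega)
      (by omega) (by omega) (by omega)

theorem twin_largest_non_genus
    (p q p' q' d0 d1 d2 d3 N : ℤ)
    (hp : Prime p) (hq : Prime q) (h2p : 2 < p) (hpq : p < q)
    (hp' : p = 2 * p' + 1) (hq' : q = 2 * q' + 1)
    (hd0 : d0 = p * q) (hd1 : d1 = p' * q) (hd2 : d2 = p * q')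
    (hd3 : 2 * d3 = p * q - 1)
    (htwin : q = p + 2) (h3p : 3 < p)
    (hN : N = (p - 1) * d1 + d2) :
    ¬ AdmRep d0 d1 d2 d3 N ∧ ∀ n : ℤ, N < n → AdmRep d0 d1 d2 d3 n := by
  obtain rfl : q' = p' + 1 := by omega
  obtain rfl : q = 2 * p' + 3 := by omega
  subst hp'
  obtain rfl : d3 = 2 * p' ^ 2 + 4 * p' + 1 := by linarith
  subst hd0 hd1 hd2
  obtain rfl : N = (2 * p' + 1) * (p' * (2 * p' + 3)) + 1 := by rw [hN]; ring
  exact ⟨not_admRep_twin (by omega), fun n hn => admRep_twin_of_lt (by omega) hn⟩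
end
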